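/- Let T be a measure-preserving action of H₃(ℝ) on a standard probability space (X, ℬ, μ) such that the central flow (T_{c(t)})_{t∈ℝ} is ergodic. Then T is spectrally symmetric: the Koopman representation U_T is unitarily equivalent to U_T ∘ θ, where θ is the flip automorphism of H₃(ℝ). In particular, the flows (T_{a(t)})_{t∈ℝ} and (T_{b(t)})_{t∈ℝ} have the same maximal spectral type. -/

import Mathlib

open Filter Topology Pointwise

/-- The real Heisenberg group `H₃(ℝ)`: `⟨a, b, c⟩` encodes the upper unitriangular `3 × 3`
matrix with entry `a` at position `(1,2)`, `b` at position `(2,3)` and `c` at position `(1,3)`. -/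
@[ext] structure H3 : Type where
  a : ℝ
  b : ℝ
  c : ℝ

namespace H3

instance : Mul H3 := ⟨fun g h => ⟨g.a + h.a, g.b + h.b, g.c + h.c + g.a * h.b⟩⟩
instance : One H3 := ⟨⟨0, 0, 0⟩⟩
instance : Inv H3 := ⟨fun g => ⟨-g.a, -g.b, g.a * g.b - g.c⟩⟩

@[simp] lemma mul_a (g h : H3) : (g * h).a = g.a + h.a := rfl
@[simp] lemma mul_b (g h : H3) : (g * h).b = g.b + h.b := rfl
@[simp] lemma mul_c (g h : H3) : (g * h).c = g.c + h.c + g.a * h.b := rfl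
@[simp] lemma one_a : (1 : H3).a = 0 := rfl
@[simp] lemma one_b : (1 : H3).b = 0 := rfl
@[simp] lemma one_c : (1 : H3).c = 0 := rfl
@[simp] lemma inv_a (g : H3) : g⁻¹.a = -g.a := rfl
@[simp] lemma inv_b (g : H3) : g⁻¹.b = -g.b := rfl
@[simp] lemma inv_c (g : H3) : g⁻¹.c = g.a * g.b - g.c := rfl

instance : Group H3 where
  mul_assoc g h k := by ext <;> simp <;> ring
  one_mul g := by ext <;> simp
  mul_one g := by ext <;> simp
  inv_mul_cancel g := by ext <;> simp

def toProd (g : H3) : ℝ × ℝ × ℝ := (g.a, g.b, g.c)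
def ofProd (p : ℝ × ℝ × ℝ) : H3 := ⟨p.1, p.2.1, p.2.2⟩

/-- The natural (Euclidean) topology of `H₃(ℝ)`. -/
instance : TopologicalSpace H3 := TopologicalSpace.induced toProd inferInstance
/-- The Borel σ-algebra of `H₃(ℝ)`. -/
instance : MeasurableSpace H3 := MeasurableSpace.comap toProd inferInstance

/-- A Haar measure on `H₃(ℝ)` (Lebesgue measure in the upper-triangular coordinates);
it satisfies `haar (box α β γ) = 8αβγ`. -/
noncomputable def haar : MeasureTheory.Measure H3 :=
  MeasureTheory.Measure.map ofProd MeasureTheory.volume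

/-- The one-parameter subgroup `a(t)` (entry `t` at position `(1,2)`). -/
def A (t : ℝ) : H3 := ⟨t, 0, 0⟩
/-- The one-parameter subgroup `b(t)` (entry `t` at position `(2,3)`). -/
def B (t : ℝ) : H3 := ⟨0, t, 0⟩
/-- The central one-parameter subgroup `c(t)` (entry `t` at position `(1,3)`). -/
def C (t : ℝ) : H3 := ⟨0, 0, t⟩

/-- The flip automorphism `θ` of `H₃(ℝ)`: `θ(a(t)) = b(t)`, `θ(b(t)) = a(t)`, `θ(c(t)) = c(-t)`. -/
def flip (g : H3) : H3 := ⟨g.b, g.a, g.a * g.b - g.c⟩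

/-- The box `I(α,β,γ) = {c(t₃)b(t₂)a(t₁) : |t₁| ≤ α, |t₂| ≤ β, |t₃| ≤ γ}`. -/
def box (α β γ : ℝ) : Set H3 := {g : H3 | |g.a| ≤ α ∧ |g.b| ≤ β ∧ |g.c| ≤ γ}

end H3

/-- A (jointly measurable) measure-preserving action of the Heisenberg group `H₃(ℝ)`
by invertible measure-preserving transformations on a measure space `(X, μ)`. -/
structure H3System : Type 1 where
  X : Type
  [ms : MeasurableSpace X]
  μ : MeasureTheory.Measure X
  T : H3 → X → X
  t_one : ∀ x, T 1 x = x
  t_mul : ∀ g h x, T (g * h) x = T g (T h x)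
  t_meas : Measurable fun p : H3 × X => T p.1 p.2
  t_mp : ∀ g, MeasureTheory.MeasurePreserving (T g) μ μ

attribute [instance] H3System.ms

section BaseDefs

open MeasureTheory

variable {Y : Type*} [MeasurableSpace Y]

/-- Mixing for a family of measure-preserving maps indexed by `H₃(ℝ)`:
`ν (S g A ∩ B) → ν A · ν B` as `g → ∞`. -/
def MixingFam (ν : Measure Y) (S : H3 → Y → Y) : Prop :=
  ∀ A B : Set Y, MeasurableSet A → MeasurableSet B →
    Tendsto (fun g : H3 => ν (S g '' A ∩ B)) (cocompact H3) (𝓝 (ν A * ν B))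

/-- Mixing of order `l` (with `l+1` sets) for a family of maps indexed by `H₃(ℝ)`. -/
def MixingOfOrderFam (ν : Measure Y) (S : H3 → Y → Y) (l : ℕ) : Prop :=
  ∀ ε : ℝ, 0 < ε → ∀ A : Fin (l + 1) → Set Y, (∀ i, MeasurableSet (A i)) →
    ∃ K : Set H3, IsCompact K ∧
      ∀ g : Fin (l + 1) → H3, (∀ i j, i ≠ j → g i * (g j)⁻¹ ∉ K) →
        |(ν (⋂ i, S (g i) '' A i)).toReal - ∏ i, (ν (A i)).toReal| < ε

/-- Mixing for a flow (a family of maps indexed by `ℝ`). -/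
def FlowMixingFam (ν : Measure Y) (S : ℝ → Y → Y) : Prop :=
  ∀ A B : Set Y, MeasurableSet A → MeasurableSet B →
    Tendsto (fun t : ℝ => ν (S t '' A ∩ B)) (cocompact ℝ) (𝓝 (ν A * ν B))

/-- Mixing of order `l` (with `l+1` sets) for a flow. -/
def FlowMixingOfOrderFam (ν : Measure Y) (S : ℝ → Y → Y) (l : ℕ) : Prop :=
  ∀ ε : ℝ, 0 < ε → ∀ A : Fin (l + 1) → Set Y, (∀ i, MeasurableSet (A i)) →
    ∃ K : Set ℝ, IsCompact K ∧
      ∀ t : Fin (l + 1) → ℝ, (∀ i j, i ≠ j → t i - t j ∉ K) →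
        |(ν (⋂ i, S (t i) '' A i)).toReal - ∏ i, (ν (A i)).toReal| < ε

namespace H3System

variable (s : H3System)

/-- `(X, ℬ, μ)` is a standard probability space. -/
def IsStdProb : Prop := StandardBorelSpace s.X ∧ IsProbabilityMeasure s.μ

/-- Freeness: for almost every point, only the identity fixes it. -/
def Free : Prop := ∀ᵐ x ∂s.μ, ∀ g : H3, s.T g x = x → g = 1

/-- Mixing of the whole `H₃(ℝ)`-action. -/
def Mixing : Prop := MixingFam s.μ s.T

/-- Mixing of the central flow `(T_{c(t)})_{t∈ℝ}`. -/
def CentralMixing : Prop := FlowMixingFam s.μ fun t => s.T (H3.C t)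

/-- Ergodicity of the central flow `(T_{c(t)})_{t∈ℝ}`. -/
def CentralErgodic : Prop :=
  ∀ A : Set s.X, MeasurableSet A → (∀ t : ℝ, s.T (H3.C t) ⁻¹' A = A) →
    s.μ A = 0 ∨ s.μ Aᶜ = 0

/-- Rigidity: some sequence `gₙ → ∞` satisfies `μ(T_{gₙ}A ∩ B) → μ(A ∩ B)`. -/
def Rigid : Prop :=
  ∃ g : ℕ → H3, Tendsto g atTop (cocompact H3) ∧
    ∀ A B : Set s.X, MeasurableSet A → MeasurableSet B →
      Tendsto (fun n => s.μ (s.T (g n) '' A ∩ B)) atTop (𝓝 (s.μ (A ∩ B)))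

/-- Weak mixing: the diagonal product action on `(X × X, μ × μ)` is ergodic. -/
def WeaklyMixing : Prop :=
  ∀ A : Set (s.X × s.X), MeasurableSet A →
    (∀ g : H3, (fun p : s.X × s.X => (s.T g p.1, s.T g p.2)) ⁻¹' A = A) →
    (s.μ.prod s.μ) A = 0 ∨ (s.μ.prod s.μ) Aᶜ = 0

/-- Zero type (mixing in infinite measure): `μ(T_g D₁ ∩ D₂) → 0` as `g → ∞`
for sets of finite measure. -/
def ZeroType : Prop :=
  ∀ D₁ D₂ : Set s.X, MeasurableSet D₁ → MeasurableSet D₂ → s.μ D₁ < ⊤ → s.μ D₂ < ⊤ →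
    Tendsto (fun g : H3 => s.μ (s.T g '' D₁ ∩ D₂)) (cocompact H3) (𝓝 0)

end H3System

/-- A (one-sided) Følner sequence of relatively compact subsets of positive finite
Haar measure in `H₃(ℝ)`. -/
def IsFolnerSeq (F : ℕ → Set H3) : Prop :=
  (∀ n, IsCompact (closure (F n)) ∧ 0 < H3.haar (F n) ∧ H3.haar (F n) < ⊤) ∧
  ∀ g : H3,
    Tendsto (fun n => H3.haar (symmDiff ((g * ·) '' F n) (F n)) / H3.haar (F n)) atTop (𝓝 0)

/-- A Rokhlin tower `(Y, f, F)` for the system `s`: `f : Y → F` is measurable and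
`f⁻¹(gH) = T_g f⁻¹(H)` for Borel `H ⊆ F` and `g` with `gH ⊆ F`. -/
def IsRokhlinTower (s : H3System) (Y : Set s.X) (f : s.X → H3) (F : Set H3) : Prop :=
  MeasurableSet Y ∧ Measurable f ∧ (∀ x ∈ Y, f x ∈ F) ∧
  ∀ (H : Set H3) (g : H3), MeasurableSet H → H ⊆ F → (g * ·) '' H ⊆ F →
    Y ∩ f ⁻¹' ((g * ·) '' H) = s.T g '' (Y ∩ f ⁻¹' H)

/-- Rank one along a given sequence `(Fₙ)`: there are Rokhlin towers `(Yₙ, fₙ, Fₙ)` such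
that every measurable set is approximated by unions of levels of the towers. -/
def RankOneAlong (s : H3System) (F : ℕ → Set H3) : Prop :=
  ∃ (Y : ℕ → Set s.X) (f : ℕ → s.X → H3),
    (∀ n, IsRokhlinTower s (Y n) (f n) (F n)) ∧
    ∀ Bset : Set s.X, MeasurableSet Bset →
      ∃ Hs : ℕ → Set H3, (∀ n, MeasurableSet (Hs n) ∧ Hs n ⊆ F n) ∧
        Tendsto (fun n => s.μ (symmDiff Bset (Y n ∩ (f n) ⁻¹' Hs n))) atTop (𝓝 0)

/-- Rank one: rank one along some Følner sequence. -/
def RankOne (s : H3System) : Prop := ∃ F : ℕ → Set H3, IsFolnerSeq F ∧ RankOneAlong s F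

section Joinings

variable (s : H3System) {ι : Type} (φ : ι → H3)

/-- A 2-fold self-joining of the sub-action `(T_{φ i})_{i∈ι}`: a measure on `X × X`,
invariant under the diagonal action, whose both marginals equal `μ`. -/
def IsSelfJoining2 (ν : Measure (s.X × s.X)) : Prop :=
  IsProbabilityMeasure ν ∧ ν.map Prod.fst = s.μ ∧ ν.map Prod.snd = s.μ ∧
  ∀ i : ι, MeasurePreserving (fun p : s.X × s.X => (s.T (φ i) p.1, s.T (φ i) p.2)) ν ν

/-- An ergodic 2-fold self-joining. -/
def IsErgodicSelfJoining2 (ν : Measure (s.X × s.X)) : Prop :=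
  IsSelfJoining2 s φ ν ∧
  ∀ A : Set (s.X × s.X), MeasurableSet A →
    (∀ i : ι, (fun p : s.X × s.X => (s.T (φ i) p.1, s.T (φ i) p.2)) ⁻¹' A = A) →
    ν A = 0 ∨ ν Aᶜ = 0

/-- The centralizer of the sub-action `(T_{φ i})_{i∈ι}`: invertible measure-preserving
transformations commuting (a.e.) with every `T_{φ i}`. -/
def InCentralizer (R : s.X → s.X) : Prop :=
  Measurable R ∧ MeasurePreserving R s.μ s.μ ∧
  (∃ R' : s.X → s.X, Measurable R' ∧ MeasurePreserving R' s.μ s.μ ∧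
    (∀ᵐ x ∂s.μ, R' (R x) = x) ∧ (∀ᵐ x ∂s.μ, R (R' x) = x)) ∧
  ∀ i : ι, ∀ᵐ x ∂s.μ, R (s.T (φ i) x) = s.T (φ i) (R x)

/-- The off-diagonal (graph) self-joining `μ_R` determined by `R`,
i.e. `μ_R(A × B) = μ(A ∩ R⁻¹B) = μ(RA ∩ B)`. -/
noncomputable def graphJoining (R : s.X → s.X) : Measure (s.X × s.X) :=
  s.μ.map fun x => (x, R x)

/-- 2-fold simplicity of the sub-action `(T_{φ i})_{i∈ι}`: every ergodic 2-fold
self-joining is either off-diagonal over the centralizer or product measure. -/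
def TwoFoldSimple : Prop :=
  ∀ ν : Measure (s.X × s.X), IsErgodicSelfJoining2 s φ ν →
    (∃ R : s.X → s.X, InCentralizer s φ R ∧ ν = graphJoining s R) ∨ ν = s.μ.prod s.μ

/-- An `l`-fold self-joining of the sub-action `(T_{φ i})_{i∈ι}`. -/
def IsSelfJoining (l : ℕ) (ν : Measure (Fin l → s.X)) : Prop :=
  IsProbabilityMeasure ν ∧ (∀ k : Fin l, ν.map (fun x => x k) = s.μ) ∧
  ∀ i : ι, MeasurePreserving (fun (x : Fin l → s.X) k => s.T (φ i) (x k)) ν ν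

/-- Simplicity: 2-fold simple, and for every `l ≥ 2` the only `l`-fold self-joining all of
whose pairwise 2-dimensional projections are `μ × μ` is the product measure. -/
def Simple : Prop :=
  TwoFoldSimple s φ ∧
  ∀ l : ℕ, 2 ≤ l → ∀ ν : Measure (Fin l → s.X), IsSelfJoining s φ l ν →
    (∀ j k : Fin l, j ≠ k → ν.map (fun x => (x j, x k)) = s.μ.prod s.μ) →
    ν = Measure.pi fun _ => s.μ

/-- The centralizer of the sub-action `(T_{φ i})_{i∈ι}` equals `{T_g : g ∈ H₃(ℝ)}`
(modulo null sets). -/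
def CentralizerEq : Prop :=
  ∀ R : s.X → s.X, InCentralizer s φ R ↔ ∃ g : H3, ∀ᵐ x ∂s.μ, R x = s.T g x

/-- Minimal self-joinings (MSJ) of the sub-action `(T_{φ i})_{i∈ι}`: simple, and the
centralizer consists of the transformations of the sub-action itself. -/
def HasMSJ : Prop :=
  Simple s φ ∧ ∀ R : s.X → s.X, InCentralizer s φ R → ∃ i : ι, ∀ᵐ x ∂s.μ, R x = s.T (φ i) x

end Joinings

end BaseDefs

section HsPart1
open Filter Topology MeasureTheory Set

lemma hs_lap_integrable_real (n : ℕ) (a : ℝ) (ha : 0 < a) :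
    IntegrableOn (fun l : ℝ => l ^ n * Real.exp (-(a * l))) (Ioi 0) := by
  have h := integrableOn_rpow_mul_exp_neg_mul_rpow (p := 1) (s := n) (b := a)
    (by have : (0:ℝ) ≤ n := Nat.cast_nonneg n
        linarith) one_pos ha
  refine h.congr_fun (fun l hl => ?_) measurableSet_Ioi
  simp [Real.rpow_natCast]

lemma hs_lap_norm (n : ℕ) (A : ℂ) (l : ℝ) (hl : 0 < l) :
    ‖(l : ℂ) ^ n * Complex.exp (-(A * l))‖ = l ^ n * Real.exp (-(A.re * l)) := by
  rw [norm_mul, Complex.norm_exp, norm_pow, Complex.norm_real, Real.norm_of_nonneg hl.le]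
  simp

lemma hs_lap_integrable (n : ℕ) (A : ℂ) (hA : 0 < A.re) :
    IntegrableOn (fun l : ℝ => (l : ℂ) ^ n * Complex.exp (-(A * l))) (Ioi 0) := by
  refine (hs_lap_integrable_real n A.re hA).mono' ?_ ?_
  · exact Continuous.aestronglyMeasurable (by fun_prop)
  · refine (ae_restrict_mem measurableSet_Ioi).mono fun l hl => ?_
    rw [hs_lap_norm n A l hl]

lemma hs_lap (n : ℕ) (A : ℂ) (hA : 0 < A.re) :
    ∫ l in Ioi (0:ℝ), (l : ℂ) ^ n * Complex.exp (-(A * l)) = (n.factorial : ℂ) / A ^ (n + 1) := by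
  have hA0 : A ≠ 0 := by
    intro h; simp [h] at hA
  induction n with
  | zero =>
    have h := integral_exp_mul_complex_Ioi (a := -A) (by simpa using hA) 0
    simpa [neg_mul] using h
  | succ n ih =>
    have hd : ∀ x ∈ Ioi (0:ℝ), HasDerivAt (fun l : ℝ => (l : ℂ) ^ (n+1) * Complex.exp (-(A * l)))
        ((n + 1 : ℂ) * ((x : ℂ) ^ n * Complex.exp (-(A * x)))
          - A * ((x : ℂ) ^ (n+1) * Complex.exp (-(A * x)))) x := by
      intro x _
      have h1 : HasDerivAt (fun z : ℂ => z ^ (n+1) * Complex.exp (-(A * z)))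
        (((n+1 : ℕ) : ℂ) * (x:ℂ) ^ n * Complex.exp (-(A * x))
          + (x:ℂ) ^ (n+1) * (Complex.exp (-(A * x)) * (-(A * 1)))) x := by
        refine (hasDerivAt_pow (n+1) (x:ℂ)).mul ?_
        exact (((hasDerivAt_id (x:ℂ)).const_mul A).neg).cexp
      convert h1.comp_ofReal using 1
      push_cast; ring
    have hIntg := ((hs_lap_integrable n A hA).const_mul (n + 1 : ℂ)).sub
      ((hs_lap_integrable (n+1) A hA).const_mul A)
    have hlim : Tendsto (fun l : ℝ => (l : ℂ) ^ (n+1) * Complex.exp (-(A * l))) atTop (𝓝 0) := by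
      rw [tendsto_zero_iff_norm_tendsto_zero]
      have := Real.tendsto_pow_mul_exp_neg_atTop_nhds_zero (n+1)
      have h2 := (this.comp (tendsto_id.const_mul_atTop hA)).const_mul ((A.re ^ (n+1))⁻¹)
      rw [mul_zero] at h2
      refine h2.congr' ?_
      filter_upwards [eventually_gt_atTop 0] with l hl
      rw [hs_lap_norm _ _ _ hl]
      simp only [Function.comp, id]
      rw [mul_pow]
      field_simp
    have hmain := integral_Ioi_of_hasDerivAt_of_tendsto (a := (0:ℝ)) (m := 0)
      (f := fun l : ℝ => (l : ℂ) ^ (n+1) * Complex.exp (-(A * l)))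
      (Continuous.continuousWithinAt (by fun_prop)) hd hIntg hlim
    rw [integral_sub ((hs_lap_integrable n A hA).const_mul _) ((hs_lap_integrable (n+1) A hA).const_mul A),
      integral_const_mul, integral_const_mul, ih] at hmain
    have h3 : A * ∫ l in Ioi (0:ℝ), (l : ℂ) ^ (n+1) * Complex.exp (-(A * l))
      = (n+1 : ℂ) * ((n.factorial : ℂ) / A ^ (n + 1)) := by
      simp at hmain
      linear_combination -hmain
    rw [Nat.factorial_succ]
    field_simp
    field_simp at h3
    push_cast
    linear_combination h3
end HsPart1

section HsPart2
open Filter Topology MeasureTheory Set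

lemma hs_int_plane (m : ℕ) (hm : 2 ≤ m) (c b : ℝ) (hc : 0 < c) (hb : 0 < b) :
    Integrable (fun x : ℂ => ((c + b * ‖x‖ ^ 2) ^ m)⁻¹) := by
  have h := integrable_rpow_neg_one_add_norm_sq (E := ℂ) (μ := volume) (r := 2 * m)
    (by rw [Complex.finrank_real_complex]
        have : (2:ℝ) ≤ m := by exact_mod_cast hm
        push_cast; linarith)
  set k := min c b with hk
  have hkpos : 0 < k := lt_min hc hb
  refine (h.const_mul ((k ^ m)⁻¹)).mono' ?_ ?_
  · refine Continuous.aestronglyMeasurable (Continuous.inv₀ (by fun_prop) ?_)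
    intro x; positivity
  · refine Eventually.of_forall fun x => ?_
    have h1 : (1 + ‖x‖ ^ 2) ^ (-(2 * (m:ℝ)) / 2) = ((1 + ‖x‖ ^ 2) ^ m)⁻¹ := by
      rw [show -(2 * (m:ℝ)) / 2 = -(m:ℝ) by ring, Real.rpow_neg (by positivity), Real.rpow_natCast]
    rw [h1, Real.norm_of_nonneg (by positivity), ← mul_inv, ← mul_pow]
    gcongr
    have : k ≤ c := min_le_left _ _
    have : k ≤ b := min_le_right _ _
    nlinarith [sq_nonneg ‖x‖]

lemma hs_int_line (m : ℕ) (B : ℂ) (hB : 0 < B.re) :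
    Integrable (fun t : ℝ => 1 / (B + Complex.I * t) ^ (m + 2)) := by
  have hre : ∀ t : ℝ, (B + Complex.I * t).re = B.re := by intro t; simp
  have hne : ∀ t : ℝ, B + Complex.I * t ≠ 0 := by
    intro t h
    have := hre t
    rw [h] at this
    simp at this
    linarith
  set k := min (B.re ^ 2) 1 with hk
  have hkpos : 0 < k := lt_min (by positivity) one_pos
  have h := ((integrable_inv_one_add_sq.comp_add_right B.im).const_mul (k⁻¹ * (B.re ^ m)⁻¹))
  refine h.mono' ?_ ?_
  · refine Continuous.aestronglyMeasurable (Continuous.div continuous_const (by fun_prop) ?_)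
    intro t; exact pow_ne_zero _ (hne t)
  · refine Eventually.of_forall fun t => ?_
    have h1 : B.re ≤ ‖B + Complex.I * t‖ := by
      rw [← hre t]; exact Complex.re_le_norm _
    have h2 : k * (1 + (t + B.im) ^ 2) ≤ ‖B + Complex.I * t‖ ^ 2 := by
      rw [← Complex.normSq_eq_norm_sq, Complex.normSq_apply]
      have : k ≤ B.re ^ 2 := min_le_left _ _
      have : k ≤ 1 := min_le_right _ _
      simp
      nlinarith [sq_nonneg (t + B.im)]
    rw [norm_div, norm_one, norm_pow, one_div, pow_add, mul_inv]
    calc (‖B + Complex.I * t‖ ^ m)⁻¹ * (‖B + Complex.I * t‖ ^ 2)⁻¹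
        ≤ (B.re ^ m)⁻¹ * (k * (1 + (t + B.im) ^ 2))⁻¹ := by gcongr
      _ = _ := by rw [mul_inv]; ring

lemma hs_planar (n : ℕ) (A : ℂ) (hA : 0 < A.re) (b : ℝ) (hb : 0 < b) (w : ℂ) :
    ∫ x : ℂ, 1 / (A + b * ‖x‖ ^ 2 + Complex.I * (inner ℝ w x : ℝ)) ^ (n + 2)
      = (Real.pi / (b * (n + 1)) : ℂ) * (1 / (A + ‖w‖ ^ 2 / (4 * b)) ^ (n + 1)) := by
  set Q : ℂ → ℂ := fun x => A + b * ‖x‖ ^ 2 + Complex.I * (inner ℝ w x : ℝ) with hQ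
  have hQre : ∀ x, (Q x).re = A.re + b * ‖x‖ ^ 2 := by
    intro x; simp [hQ, ← Complex.ofReal_pow]
  have hQpos : ∀ x, 0 < (Q x).re := by intro x; rw [hQre]; positivity
  have hfac : ((n + 1).factorial : ℂ) ≠ 0 := by exact_mod_cast (n+1).factorial_ne_zero
  have hQcont : Continuous Q := by
    simp only [hQ]
    fun_prop
  have e1 : ∀ x, 1 / (Q x) ^ (n+2) = ((n+1).factorial : ℂ)⁻¹ *
      ∫ l in Ioi (0:ℝ), (l : ℂ) ^ (n+1) * Complex.exp (-(Q x * l)) := by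
    intro x
    rw [hs_lap (n+1) _ (hQpos x)]
    field_simp
  have hIntg : Integrable (Function.uncurry fun (x : ℂ) (l : ℝ) =>
      (l : ℂ) ^ (n+1) * Complex.exp (-(Q x * l))) (volume.prod (volume.restrict (Ioi 0))) := by
    rw [integrable_prod_iff]
    · refine ⟨Eventually.of_forall fun x => ?_, ?_⟩
      · have h0 := hs_lap_integrable (n+1) (Q x) (hQpos x)
        exact h0
      have h1 := (hs_int_plane (n+2) (by omega) A.re b hA hb).const_mul ((n+1).factorial : ℝ)
      refine h1.congr (Eventually.of_forall fun x => ?_)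
      have h2 : ∫ l in Ioi (0:ℝ), ‖(l : ℂ) ^ (n+1) * Complex.exp (-(Q x * l))‖
          = ∫ l in Ioi (0:ℝ), l ^ (n+1) * Real.exp (-((Q x).re * l)) := by
        refine setIntegral_congr_fun measurableSet_Ioi fun l hl => ?_
        exact hs_lap_norm _ _ _ hl
      have h3 := hs_lap (n+1) ((Q x).re : ℂ) (by simpa using hQpos x)
      have h4 : ((∫ l in Ioi (0:ℝ), l ^ (n+1) * Real.exp (-((Q x).re * l)) : ℝ) : ℂ)
         = (((n+1).factorial : ℝ) * (((Q x).re) ^ (n+2))⁻¹ : ℝ) := by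
        rw [← integral_complex_ofReal]
        push_cast
        rw [h3]; rfl
      have h5 := Complex.ofReal_injective h4
      simp only [Function.uncurry]
      rw [h2, h5, hQre]
    · refine Continuous.aestronglyMeasurable ?_
      simp only [Function.uncurry_def]
      fun_prop
  have e2 : ∀ l ∈ Ioi (0:ℝ), ∫ x : ℂ, (l : ℂ) ^ (n+1) * Complex.exp (-(Q x * l))
      = (Real.pi / b : ℂ) * ((l : ℂ) ^ n * Complex.exp (-((A + ‖w‖ ^ 2 / (4 * b)) * l))) := by
    intro l hl
    have hl : 0 < l := hl
    have hlc : (l : ℂ) ≠ 0 := by exact_mod_cast hl.ne'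
    have hbc : (b : ℂ) ≠ 0 := by exact_mod_cast hb.ne'
    have h1 := GaussianFourier.integral_cexp_neg_mul_sq_norm_add (V := ℂ) (b := (b * l : ℂ))
      (by simp; positivity) (-(Complex.I * l)) w
    have h2 : ∀ x : ℂ, (l : ℂ) ^ (n+1) * Complex.exp (-(Q x * l)) =
        ((l : ℂ) ^ (n+1) * Complex.exp (-(A * l))) *
        Complex.exp (-(b * l : ℂ) * ‖x‖ ^ 2 + -(Complex.I * l) * (inner ℝ w x : ℝ)) := by
      intro x
      rw [mul_assoc, ← Complex.exp_add]
      congr 2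
      simp only [hQ]; ring
    simp_rw [h2]
    rw [integral_const_mul, h1, Complex.finrank_real_complex]
    rw [show ((2:ℕ):ℂ) / 2 = 1 by norm_num, Complex.cpow_one]
    have hexp : Complex.exp (-((A + ‖w‖ ^ 2 / (4 * b)) * l)) = Complex.exp (-(A * l)) *
        Complex.exp ((-(Complex.I * l)) ^ 2 * ‖w‖ ^ 2 / (4 * (b * l))) := by
      rw [← Complex.exp_add]
      congr 1
      rw [mul_comm Complex.I, neg_sq, mul_pow, Complex.I_sq]
      field_simp
      ring
    rw [hexp]
    field_simp
    ring
  have hA' : 0 < (A + ‖w‖ ^ 2 / (4 * b) : ℂ).re := by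
    have : (A + ‖w‖ ^ 2 / (4 * b) : ℂ) = A + ((‖w‖ ^ 2 / (4 * b) : ℝ) : ℂ) := by push_cast; rfl
    rw [this, Complex.add_re, Complex.ofReal_re]
    positivity
  calc ∫ x : ℂ, 1 / (Q x) ^ (n + 2)
      = ((n+1).factorial : ℂ)⁻¹ * ∫ x : ℂ, ∫ l in Ioi (0:ℝ), (l : ℂ) ^ (n+1) * Complex.exp (-(Q x * l)) := by
        rw [← integral_const_mul]; exact integral_congr_ae (Eventually.of_forall e1)
    _ = ((n+1).factorial : ℂ)⁻¹ * ∫ l in Ioi (0:ℝ), ∫ x : ℂ, (l : ℂ) ^ (n+1) * Complex.exp (-(Q x * l)) := by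
        rw [integral_integral_swap hIntg]
    _ = ((n+1).factorial : ℂ)⁻¹ * ((Real.pi / b : ℂ) * ((n.factorial : ℂ) / (A + ‖w‖ ^ 2 / (4 * b)) ^ (n + 1))) := by
        rw [setIntegral_congr_fun measurableSet_Ioi e2, integral_const_mul, hs_lap n _ hA']
    _ = _ := by
        rw [Nat.factorial_succ]
        have : (n.factorial : ℂ) ≠ 0 := by exact_mod_cast n.factorial_ne_zero
        have hbc : (b : ℂ) ≠ 0 := by exact_mod_cast hb.ne'
        have h1 : ((n:ℂ)+1) ≠ 0 := by exact_mod_cast n.succ_ne_zero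
        have h0 : (A + ‖w‖ ^ 2 / (4 * b) : ℂ) ^ (n+1) ≠ 0 := by
          refine pow_ne_zero _ ?_
          intro h; rw [h] at hA'; simp at hA'
        generalize (A + ‖w‖ ^ 2 / (4 * b) : ℂ) ^ (n+1) = Z at h0 ⊢
        push_cast
        field_simp
end HsPart2

section HsPart3
open Filter Topology MeasureTheory Set
open scoped FourierTransform

lemma hs_inv (n : ℕ) (B : ℂ) (hB : 0 < B.re) (l : ℝ) (hl : 0 < l) :
    ∫ t : ℝ, Complex.exp (-(Complex.I * t * l)) * (1 / (B - Complex.I * t) ^ (n + 2))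
      = (2 * Real.pi / ((n+1).factorial : ℂ)) * ((l : ℂ) ^ (n+1) * Complex.exp (-(B * l))) := by
  set h : ℝ → ℂ := (Ioi (0:ℝ)).indicator (fun l : ℝ => (l : ℂ) ^ (n+1) * Complex.exp (-(B * l))) with hh
  have hfac : ((n + 1).factorial : ℂ) ≠ 0 := by exact_mod_cast (n+1).factorial_ne_zero
  have hcont : ContinuousAt h l := by
    have : h =ᶠ[𝓝 l] (fun l : ℝ => (l : ℂ) ^ (n+1) * Complex.exp (-(B * l))) := by
      filter_upwards [Ioi_mem_nhds hl] with y hy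
      simp only [hh, indicator_of_mem hy]
    refine ContinuousAt.congr ?_ this.symm
    exact Continuous.continuousAt (by fun_prop)
  have hIntg : Integrable h := (integrable_indicator_iff measurableSet_Ioi).2 (hs_lap_integrable (n+1) B hB)
  have hF : 𝓕 h = fun ξ : ℝ => ((n+1).factorial : ℂ) * (1 / (B + Complex.I * ((2 * Real.pi * ξ : ℝ) : ℂ)) ^ (n + 2)) := by
    funext ξ
    rw [Real.fourier_real_eq_integral_exp_smul]
    have e1 : ∀ v : ℝ, Complex.exp (((-2 * Real.pi * v * ξ : ℝ) : ℂ) * Complex.I) • h v =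
      (Ioi (0:ℝ)).indicator (fun l : ℝ => (l : ℂ) ^ (n+1) *
        Complex.exp (-((B + Complex.I * ((2 * Real.pi * ξ : ℝ) : ℂ)) * l))) v := by
      intro v
      by_cases hv : v ∈ Ioi (0:ℝ)
      · rw [hh, indicator_of_mem hv, indicator_of_mem hv, smul_eq_mul, mul_left_comm, ← Complex.exp_add]
        congr 2
        push_cast; ring
      · rw [hh, indicator_of_notMem hv, indicator_of_notMem hv, smul_zero]
    rw [integral_congr_ae (Eventually.of_forall e1), integral_indicator measurableSet_Ioi,
      hs_lap (n+1) _ (by simpa using hB)]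
    ring
  have hFint : Integrable (𝓕 h) := by
    rw [hF]
    exact ((hs_int_line n B hB).comp_mul_left' (by positivity : (2 * Real.pi) ≠ 0)).const_mul _
  have key := hIntg.fourierInv_fourier_eq hFint hcont
  rw [Real.fourierInv_eq_fourier_neg, Real.fourier_real_eq_integral_exp_smul, hF] at key
  have e2 : ∀ v : ℝ, Complex.exp (((-2 * Real.pi * v * (-l) : ℝ) : ℂ) * Complex.I) •
      (((n+1).factorial : ℂ) * (1 / (B + Complex.I * ((2 * Real.pi * v : ℝ) : ℂ)) ^ (n + 2)))
      = ((n+1).factorial : ℂ) * (fun t : ℝ => Complex.exp (-(Complex.I * t * l)) * (1 / (B - Complex.I * t) ^ (n + 2)))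
        ((-(2 * Real.pi)) * v) := by
    intro v
    simp only [smul_eq_mul]
    rw [mul_left_comm]
    congr 3
    · push_cast; ring
    · push_cast; ring
  rw [integral_congr_ae (Eventually.of_forall e2), integral_const_mul,
    Measure.integral_comp_mul_left (fun t : ℝ => Complex.exp (-(Complex.I * t * l)) * (1 / (B - Complex.I * t) ^ (n + 2))) (-(2 * Real.pi)),
    hh, indicator_of_mem (show l ∈ Ioi (0:ℝ) from hl)] at key
  rw [← key]
  have : |(-(2 * Real.pi))⁻¹| = (2 * Real.pi)⁻¹ := by
    rw [inv_neg, abs_neg, abs_of_pos (by positivity)]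
  rw [this, Complex.real_smul]
  have hpi : (Real.pi : ℂ) ≠ 0 := by exact_mod_cast Real.pi_ne_zero
  generalize (∫ t : ℝ, Complex.exp (-(Complex.I * t * l)) * (1 / (B - Complex.I * t) ^ (n + 2))) = Z
  push_cast
  field_simp

lemma hs_beta (n : ℕ) (A B : ℂ) (hA : 0 < A.re) (hB : 0 < B.re) :
    ∫ t : ℝ, 1 / (A + Complex.I * t) ^ (n + 2) * (1 / (B - Complex.I * t) ^ (n + 2))
      = (2 * Real.pi * ((2 * n + 2).factorial : ℂ) / ((n+1).factorial : ℂ) ^ 2) *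
        (1 / (A + B) ^ (2 * n + 3)) := by
  have hfac : ((n + 1).factorial : ℂ) ≠ 0 := by exact_mod_cast (n+1).factorial_ne_zero
  have hpos : ∀ t : ℝ, 0 < (A + Complex.I * t).re := by intro t; simpa using hA
  have hline : Integrable (fun t : ℝ => 1 / (B - Complex.I * t) ^ (n + 2)) := by
    have := (hs_int_line n B hB).comp_neg
    refine this.congr (Eventually.of_forall fun t => ?_)
    simp only []
    congr 2
    push_cast; ring
  have e1 : ∀ t : ℝ, 1 / (A + Complex.I * t) ^ (n + 2) * (1 / (B - Complex.I * t) ^ (n + 2))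
     = ((n+1).factorial : ℂ)⁻¹ * ∫ l in Ioi (0:ℝ), ((l : ℂ) ^ (n+1) * Complex.exp (-(A * l))) *
       (Complex.exp (-(Complex.I * t * l)) * (1 / (B - Complex.I * t) ^ (n + 2))) := by
    intro t
    have h1 : ∀ l : ℝ, ((l : ℂ) ^ (n+1) * Complex.exp (-(A * l))) *
       (Complex.exp (-(Complex.I * t * l)) * (1 / (B - Complex.I * t) ^ (n + 2)))
       = ((l : ℂ) ^ (n+1) * Complex.exp (-((A + Complex.I * t) * l))) * (1 / (B - Complex.I * t) ^ (n + 2)) := by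
      intro l
      rw [add_mul, neg_add, Complex.exp_add]; ring
    simp_rw [h1]
    rw [integral_mul_const, hs_lap (n+1) _ (hpos t)]
    field_simp
  have hIntg : Integrable (Function.uncurry fun (t : ℝ) (l : ℝ) => ((l : ℂ) ^ (n+1) * Complex.exp (-(A * l))) *
       (Complex.exp (-(Complex.I * t * l)) * (1 / (B - Complex.I * t) ^ (n + 2))))
       (volume.prod (volume.restrict (Ioi 0))) := by
    have h0 := hline.mul_prod (hs_lap_integrable (n+1) A hA)
    have hB' : Continuous fun t : ℝ => 1 / (B - Complex.I * t) ^ (n + 2) := by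
      refine Continuous.div continuous_const (by fun_prop) ?_
      intro t
      refine pow_ne_zero _ fun h => ?_
      have : (B - Complex.I * t).re = B.re := by simp
      rw [h] at this; simp at this; linarith
    refine h0.mono ?_ (Eventually.of_forall ?_)
    · refine Continuous.aestronglyMeasurable ?_
      simp only [Function.uncurry_def]
      have := hB'.comp (continuous_fst (X := ℝ) (Y := ℝ))
      simp only [Function.comp_def] at this
      fun_prop
    · rintro ⟨t, l⟩
      simp only [Function.uncurry]
      rw [norm_mul, norm_mul (Complex.exp _), norm_mul (1 / _)]
      have : ‖Complex.exp (-(Complex.I * t * l))‖ = 1 := by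
        rw [Complex.norm_exp]; simp
      rw [this, one_mul, mul_comm]
  rw [integral_congr_ae (Eventually.of_forall e1), integral_const_mul, integral_integral_swap hIntg]
  have e2 : ∀ l ∈ Ioi (0:ℝ), ∫ t : ℝ, ((l : ℂ) ^ (n+1) * Complex.exp (-(A * l))) *
       (Complex.exp (-(Complex.I * t * l)) * (1 / (B - Complex.I * t) ^ (n + 2)))
       = (2 * Real.pi / ((n+1).factorial : ℂ)) * ((l : ℂ) ^ (2*n+2) * Complex.exp (-((A + B) * l))) := by
    intro l hl
    rw [integral_const_mul, hs_inv n B hB l hl, add_mul, neg_add, Complex.exp_add]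
    ring
  rw [setIntegral_congr_fun measurableSet_Ioi e2, integral_const_mul,
    hs_lap (2*n+2) _ (by rw [Complex.add_re]; positivity)]
  field_simp
end HsPart3

section HsPart4
open Filter Topology MeasureTheory Set

noncomputable def hsω (z w : ℂ) : ℝ := z.re * w.im - z.im * w.re

lemma hsω_cont : Continuous fun p : ℂ × ℂ => hsω p.1 p.2 := by
  unfold hsω; fun_prop

noncomputable def hsK (n : ℕ) (s κ : ℝ) (p : ℂ × ℝ) : ℂ :=
  1 / ((s : ℂ) + κ * ‖p.1‖ ^ 2 + Complex.I * p.2) ^ n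

lemma hs_q_ge_re (c t : ℝ) : c ≤ ‖(c : ℂ) + Complex.I * t‖ := by
  have := Complex.abs_re_le_norm ((c : ℂ) + Complex.I * t)
  simp at this
  exact (le_abs_self c).trans this

lemma hs_q_ge_t (c t k : ℝ) (hk : 0 < k) (hkc : k ≤ c) (hk1 : k ≤ 1) :
    k * (1 + ‖t‖ ^ 2) ^ (1/2 : ℝ) ≤ ‖(c : ℂ) + Complex.I * t‖ := by
  rw [← Real.sqrt_eq_rpow, Complex.norm_eq_sqrt_sq_add_sq]
  simp
  rw [← Real.sqrt_sq hk.le, ← Real.sqrt_mul (by positivity)]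
  apply Real.sqrt_le_sqrt
  nlinarith [mul_nonneg (sub_nonneg.2 hkc) (by linarith : 0 ≤ c + k), sq_nonneg t,
    mul_nonneg (sub_nonneg.2 hk1) (by linarith : 0 ≤ 1 + k), mul_nonneg (mul_nonneg (sub_nonneg.2 hk1) (by linarith : 0 ≤ 1 + k)) (sq_nonneg t)]

lemma hs_ker_cont (n : ℕ) (s κ : ℝ) (hs : 0 < s) (hκ : 0 ≤ κ) : Continuous (hsK n s κ) := by
  unfold hsK
  refine Continuous.div continuous_const (by fun_prop) ?_
  intro p
  refine pow_ne_zero _ fun h => ?_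
  have : ((s : ℂ) + κ * ‖p.1‖ ^ 2 + Complex.I * p.2).re = s + κ * ‖p.1‖ ^ 2 := by
    simp [← Complex.ofReal_pow]
  rw [h] at this; simp at this; nlinarith [sq_nonneg ‖p.1‖]

lemma hs_rp (k a Q : ℝ) (hk : 0 < k) (ha : 0 < a) (h : k * a ≤ Q) (r : ℝ) (hr : 0 ≤ r) :
    Q ^ (-r) ≤ k ^ (-r) * a ^ (-r) := by
  rw [← Real.mul_rpow hk.le ha.le]
  exact Real.rpow_le_rpow_of_nonpos (by positivity) h (by linarith)

lemma hs_ker_int3 (s κ : ℝ) (hs : 0 < s) (hκ : 0 < κ) : Integrable (hsK 3 s κ) (volume.prod volume) := by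
  have h1 := integrable_rpow_neg_one_add_norm_sq (E := ℂ) (μ := volume) (r := 3)
    (by rw [Complex.finrank_real_complex]; norm_num)
  have h2 := integrable_rpow_neg_one_add_norm_sq (E := ℝ) (μ := volume) (r := 3/2)
    (by rw [Module.finrank_self]; norm_num)
  set k := min 1 (min s κ) with hk
  have hk0 : 0 < k := by simp [hk, hs, hκ]
  have hk1 : k ≤ 1 := by simp [hk]
  have hks : k ≤ s := by simp [hk]
  have hkκ : k ≤ κ := by simp [hk]
  refine ((h1.mul_prod h2).const_mul (k ^ (-(3/2) : ℝ) * k ^ (-(3/2) : ℝ))).mono'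
    (hs_ker_cont 3 s κ hs hκ.le).aestronglyMeasurable (Eventually.of_forall ?_)
  rintro ⟨z, t⟩
  have e : ((s : ℂ) + κ * ‖z‖ ^ 2 + Complex.I * t) = ((s + κ * ‖z‖ ^ 2 : ℝ) : ℂ) + Complex.I * t := by
    push_cast; ring
  simp only [hsK]
  rw [e, norm_div, norm_pow, norm_one]
  set Q := ‖((s + κ * ‖z‖ ^ 2 : ℝ) : ℂ) + Complex.I * t‖ with hQ
  have hz : 0 ≤ ‖z‖ ^ 2 := by positivity
  have q1 : k * (1 + ‖z‖ ^ 2) ≤ Q := by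
    refine le_trans ?_ (hs_q_ge_re _ t)
    nlinarith [mul_le_mul_of_nonneg_right hkκ hz]
  have q2 : k * (1 + ‖t‖ ^ 2) ^ (1/2 : ℝ) ≤ Q := by
    refine hs_q_ge_t _ t k hk0 ?_ hk1
    nlinarith
  have hQ0 : 0 < Q := lt_of_lt_of_le (by positivity) q1
  have r1 := hs_rp k _ Q hk0 (by positivity) q1 (3/2) (by norm_num)
  have r2 := hs_rp k _ Q hk0 (by positivity) q2 (3/2) (by norm_num)
  rw [← Real.rpow_mul (by positivity)] at r2
  have e3 : 1 / Q ^ 3 = Q ^ (-(3/2) : ℝ) * Q ^ (-(3/2) : ℝ) := by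
    rw [← Real.rpow_add hQ0, one_div, ← Real.rpow_natCast, ← Real.rpow_neg hQ0.le]; norm_num
  rw [e3]
  calc _ ≤ (k ^ (-(3/2) : ℝ) * (1 + ‖z‖ ^ 2) ^ (-(3/2) : ℝ)) * (k ^ (-(3/2) : ℝ) * (1 + ‖t‖ ^ 2) ^ ((1/2 : ℝ) * (-(3/2)) : ℝ)) :=
        mul_le_mul r1 r2 (by positivity) (by positivity)
    _ = _ := by
        norm_num
        ring

lemma hs_ker_int4 (s κ : ℝ) (hs : 0 < s) (hκ : 0 < κ) : Integrable (hsK 4 s κ) (volume.prod volume) := by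
  refine ((hs_ker_int3 s κ hs hκ).const_mul ((s : ℂ)⁻¹)).mono
    (hs_ker_cont 4 s κ hs hκ.le).aestronglyMeasurable (Eventually.of_forall ?_)
  rintro ⟨z, t⟩
  have e : ((s : ℂ) + κ * ‖z‖ ^ 2 + Complex.I * t) = ((s + κ * ‖z‖ ^ 2 : ℝ) : ℂ) + Complex.I * t := by
    push_cast; ring
  simp only [hsK]
  rw [e, norm_mul, norm_div, norm_div, norm_pow, norm_pow, norm_one, norm_inv, Complex.norm_real, Real.norm_of_nonneg hs.le]
  set Q := ‖((s + κ * ‖z‖ ^ 2 : ℝ) : ℂ) + Complex.I * t‖ with hQ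
  have hQ0 : s ≤ Q := le_trans (by nlinarith [mul_nonneg hκ.le (sq_nonneg ‖z‖)]) (hs_q_ge_re _ t)
  have hQ1 : 0 < Q := hs.trans_le hQ0
  rw [inv_mul_eq_div, div_div, pow_succ]
  gcongr

lemma hs_ker_int4' (s κ ε : ℝ) (hs : 0 < s) (hκ : 0 < κ) (hε : 0 < ε) :
    Integrable (fun p : ℂ × (ℂ × ℝ) => hsK 4 (s + ε * ‖p.1‖ ^ 2) κ p.2) (volume.prod (volume.prod volume)) := by
  have h1 := integrable_rpow_neg_one_add_norm_sq (E := ℂ) (μ := volume) (r := 8/3)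
    (by rw [Complex.finrank_real_complex]; norm_num)
  have h2 := integrable_rpow_neg_one_add_norm_sq (E := ℝ) (μ := volume) (r := 4/3)
    (by rw [Module.finrank_self]; norm_num)
  set k := min 1 (min s (min κ ε)) with hk
  have hk0 : 0 < k := by simp [hk, hs, hκ, hε]
  have hk1 : k ≤ 1 := by simp [hk]
  have hks : k ≤ s := by simp [hk]
  have hkκ : k ≤ κ := by simp [hk]
  have hkε : k ≤ ε := by simp [hk]
  refine ((h1.mul_prod (h1.mul_prod h2)).const_mul (k ^ (-(4/3) : ℝ) * k ^ (-(4/3) : ℝ) * k ^ (-(4/3) : ℝ))).mono'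
    ?_ (Eventually.of_forall ?_)
  · refine Continuous.aestronglyMeasurable ?_
    unfold hsK
    refine Continuous.div continuous_const (by fun_prop) ?_
    intro p
    refine pow_ne_zero _ fun h => ?_
    have : (((s + ε * ‖p.1‖ ^ 2 : ℝ) : ℂ) + κ * ‖p.2.1‖ ^ 2 + Complex.I * p.2.2).re = s + ε * ‖p.1‖ ^ 2 + κ * ‖p.2.1‖ ^ 2 := by
      simp [← Complex.ofReal_pow]
    rw [h] at this; simp at this
    nlinarith [mul_nonneg hκ.le (sq_nonneg ‖p.2.1‖), mul_nonneg hε.le (sq_nonneg ‖p.1‖)]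
  rintro ⟨x, z, t⟩
  have e : (((s + ε * ‖x‖ ^ 2 : ℝ) : ℂ) + κ * ‖z‖ ^ 2 + Complex.I * t) = ((s + ε * ‖x‖ ^ 2 + κ * ‖z‖ ^ 2 : ℝ) : ℂ) + Complex.I * t := by
    push_cast; ring
  simp only [hsK]
  rw [e, norm_div, norm_pow, norm_one]
  set Q := ‖((s + ε * ‖x‖ ^ 2 + κ * ‖z‖ ^ 2 : ℝ) : ℂ) + Complex.I * t‖ with hQ
  have hz : 0 ≤ ‖z‖ ^ 2 := by positivity
  have hx : 0 ≤ ‖x‖ ^ 2 := by positivity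
  have p1 := mul_le_mul_of_nonneg_right hkκ hz
  have p2 := mul_le_mul_of_nonneg_right hkε hx
  have p3 := mul_nonneg hκ.le hz
  have p4 := mul_nonneg hε.le hx
  have q1 : k * (1 + ‖z‖ ^ 2) ≤ Q := by
    refine le_trans ?_ (hs_q_ge_re _ t)
    linarith
  have q3 : k * (1 + ‖x‖ ^ 2) ≤ Q := by
    refine le_trans ?_ (hs_q_ge_re _ t)
    linarith
  have q2 : k * (1 + ‖t‖ ^ 2) ^ (1/2 : ℝ) ≤ Q := by
    refine hs_q_ge_t _ t k hk0 ?_ hk1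
    linarith
  have hQ0 : 0 < Q := lt_of_lt_of_le (by positivity) q1
  have r1 := hs_rp k _ Q hk0 (by positivity) q1 (4/3) (by norm_num)
  have r2 := hs_rp k _ Q hk0 (by positivity) q2 (4/3) (by norm_num)
  have r3 := hs_rp k _ Q hk0 (by positivity) q3 (4/3) (by norm_num)
  rw [← Real.rpow_mul (by positivity)] at r2
  have e3 : 1 / Q ^ 4 = Q ^ (-(4/3) : ℝ) * (Q ^ (-(4/3) : ℝ) * Q ^ (-(4/3) : ℝ)) := by
    rw [← Real.rpow_add hQ0, ← Real.rpow_add hQ0, one_div, ← Real.rpow_natCast, ← Real.rpow_neg hQ0.le]; norm_num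
  rw [e3]
  calc _ ≤ (k ^ (-(4/3) : ℝ) * (1 + ‖x‖ ^ 2) ^ (-(4/3) : ℝ)) * ((k ^ (-(4/3) : ℝ) * (1 + ‖z‖ ^ 2) ^ (-(4/3) : ℝ)) * (k ^ (-(4/3) : ℝ) * (1 + ‖t‖ ^ 2) ^ ((1/2 : ℝ) * (-(4/3)) : ℝ))) :=
        mul_le_mul r3 (mul_le_mul r1 r2 (by positivity) (by positivity)) (by positivity) (by positivity)
    _ = _ := by
        norm_num
        ring

/-- Shear transformations preserve Lebesgue measure. -/
lemma hs_shear (a : ℂ) (c : ℂ → ℝ) (hc : Measurable c) :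
    MeasurePreserving (fun p : ℂ × ℝ => (p.1 + a, p.2 + c p.1)) (volume.prod volume) (volume.prod volume) := by
  refine (measurePreserving_add_right volume a).skew_product (g := fun z t => t + c z) (by
    simp only [Function.uncurry_def]; fun_prop) (Eventually.of_forall fun z => ?_)
  exact (measurePreserving_add_right volume (c z)).map_eq
end HsPart4

section HsPart5
open Filter Topology MeasureTheory Set

noncomputable def hsSh (ξ : ℂ) (p r : ℂ × ℝ) : ℂ × ℝ :=
  (r.1 + (- p.1 - ξ), r.2 + (- p.2 - (hsω p.1 ξ + hsω (p.1 + ξ) r.1) / 2))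

lemma hsSh_mp (ξ : ℂ) (p : ℂ × ℝ) :
    MeasurePreserving (hsSh ξ p) (volume.prod volume) (volume.prod volume) := by
  refine hs_shear _ (fun z => - p.2 - (hsω p.1 ξ + hsω (p.1 + ξ) z) / 2) ?_
  unfold hsω; fun_prop

lemma hsSh_cont (ξ : ℂ) : Continuous fun q : (ℂ × ℝ) × (ℂ × ℝ) => hsSh ξ q.1 q.2 := by
  unfold hsSh hsω; fun_prop

lemma hsSh_mp2 (ξ : ℂ) :
    MeasurePreserving (fun q : (ℂ × ℝ) × (ℂ × ℝ) => (q.1, hsSh ξ q.1 q.2))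
      ((volume.prod volume).prod (volume.prod volume)) ((volume.prod volume).prod (volume.prod volume)) := by
  refine (MeasurePreserving.id _).skew_product (g := hsSh ξ) (hsSh_cont ξ).measurable
    (Eventually.of_forall fun p => (hsSh_mp ξ p).map_eq)

lemma hs_conv_ker (s : ℝ) (hs : 0 < s) (ξ : ℂ) (r : ℂ × ℝ)
    (hIntg : Integrable (fun p : ℂ × ℝ => hsK 4 s (1/4) p * hsK 4 s (1/4) (hsSh ξ p r)) (volume.prod volume)) :
    ∫ p : ℂ × ℝ, hsK 4 s (1/4) p * hsK 4 s (1/4) (hsSh ξ p r) ∂(volume.prod volume)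
     = (2 * Real.pi * ((2 * 2 + 2).factorial : ℂ) / ((2+1).factorial : ℂ) ^ 2) *
       (Real.pi / (((1/2 : ℝ) : ℂ) * (((5 : ℕ) : ℂ) + 1)) : ℂ) * hsK 6 (2 * s + ‖ξ‖ ^ 2 / 4) (1/4) r := by
  rw [integral_prod _ hIntg]
  obtain ⟨u, t⟩ := r
  have e1 : ∀ x : ℂ, ∫ y : ℝ, hsK 4 s (1/4) (x, y) * hsK 4 s (1/4) (hsSh ξ (x, y) (u, t))
     = (2 * Real.pi * ((2 * 2 + 2).factorial : ℂ) / ((2+1).factorial : ℂ) ^ 2) *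
       (1 / (((s + 1/4 * ‖x‖ ^ 2 : ℝ) : ℂ) + (((s + 1/4 * ‖u + (-x - ξ)‖ ^ 2 : ℝ) : ℂ) +
         Complex.I * ((t - (hsω x ξ + hsω (x + ξ) u) / 2 : ℝ) : ℂ))) ^ 7) := by
    intro x
    rw [← hs_beta 2 _ _ (by simp only [Complex.ofReal_re]; positivity) (by
      simp [-Complex.ofReal_add, -Complex.ofReal_sub]; positivity)]
    congr 1
    funext y
    simp only [hsK, hsSh]
    congr 2
    · push_cast; ring
    · push_cast; ring
  simp_rw [e1]
  generalize (2 * Real.pi * ((2 * 2 + 2).factorial : ℂ) / ((2+1).factorial : ℂ) ^ 2) = Z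
  rw [integral_const_mul, mul_assoc]
  congr 1
  rw [← integral_add_right_eq_self _ ((u - ξ) / 2)]
  have hp := hs_planar 5 (((2 * s + ‖u - ξ‖ ^ 2 / 8 : ℝ) : ℂ) + Complex.I * t)
    (by simp [-Complex.ofReal_add, -Complex.ofReal_div]; positivity) (1/2) (by norm_num) (Complex.I * (u + ξ) / 2)
  have nsq : ∀ z : ℂ, ‖z‖ ^ 2 = z.re ^ 2 + z.im ^ 2 := by
    intro z; rw [← Complex.normSq_eq_norm_sq, Complex.normSq_apply]; ring
  have inn : ∀ a b : ℂ, (inner ℝ a b : ℝ) = a.re * b.re + a.im * b.im := by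
    intro a b; simp [Complex.inner]; ring
  have e2 : ∀ x : ℂ, (((s + 1/4 * ‖x + (u - ξ) / 2‖ ^ 2 : ℝ) : ℂ) + (((s + 1/4 * ‖u + (-(x + (u - ξ) / 2) - ξ)‖ ^ 2 : ℝ) : ℂ) +
         Complex.I * ((t - (hsω (x + (u - ξ) / 2) ξ + hsω ((x + (u - ξ) / 2) + ξ) u) / 2 : ℝ) : ℂ)))
      = (((2 * s + ‖u - ξ‖ ^ 2 / 8 : ℝ) : ℂ) + Complex.I * t) + ((1/2 : ℝ) : ℂ) * ‖x‖ ^ 2 + Complex.I * (inner ℝ (Complex.I * (u + ξ) / 2) x : ℝ) := by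
    intro x
    rw [nsq, nsq, nsq, ← Complex.ofReal_pow, nsq]
    apply Complex.ext
    · simp [-Complex.ofReal_add, -Complex.ofReal_sub, -Complex.ofReal_div, -Complex.ofReal_mul, -Complex.ofReal_pow]
      ring
    · simp [-Complex.ofReal_add, -Complex.ofReal_sub, -Complex.ofReal_div, -Complex.ofReal_mul, -Complex.ofReal_pow, hsω, inn]
      ring
  simp_rw [e2]
  rw [hp]
  congr 1
  simp only [hsK]
  congr 2
  rw [← Complex.ofReal_pow, ← Complex.ofReal_pow, nsq, nsq, nsq, nsq]
  have a1 : (Complex.I * (u + ξ) / 2).re = - (u.im + ξ.im) / 2 := by simp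
  have a2 : (Complex.I * (u + ξ) / 2).im = (u.re + ξ.re) / 2 := by simp
  rw [a1, a2]
  simp only [Complex.sub_re, Complex.sub_im]
  push_cast
  ring

lemma hs_conv (s : ℝ) (hs : 0 < s) (ξ : ℂ) (τ : ℝ) (φ : ℂ × ℝ → ℂ) (hφ : Measurable φ) (M : ℝ)
    (hM : ∀ p, ‖φ p‖ ≤ M) :
    ∫ p : ℂ × ℝ, ∫ q : ℂ × ℝ, hsK 4 s (1/4) p * (hsK 4 s (1/4) q *
      φ (p.1 + ξ + q.1, p.2 + τ + q.2 + (hsω p.1 ξ + hsω (p.1 + ξ) q.1) / 2)) ∂(volume.prod volume) ∂(volume.prod volume)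
     = ∫ r : ℂ × ℝ, (2 * Real.pi * ((2 * 2 + 2).factorial : ℂ) / ((2+1).factorial : ℂ) ^ 2) *
       (Real.pi / (((1/2 : ℝ) : ℂ) * (((5 : ℕ) : ℂ) + 1)) : ℂ) * hsK 6 (2 * s + ‖ξ‖ ^ 2 / 4) (1/4) r * φ (r.1, r.2 + τ)
        ∂(volume.prod volume) := by
  have hK := hs_ker_int4 s (1/4) hs (by norm_num)
  have hKc := hs_ker_cont 4 s (1/4) hs (by norm_num)
  have j1 : Integrable (fun q : (ℂ × ℝ) × (ℂ × ℝ) => hsK 4 s (1/4) q.1 * hsK 4 s (1/4) (hsSh ξ q.1 q.2))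
    ((volume.prod volume).prod (volume.prod volume)) :=
    (hsSh_mp2 ξ).integrable_comp_of_integrable (hK.mul_prod hK)
  have hφm : Measurable fun r : ℂ × ℝ => φ (r.1, r.2 + τ) := hφ.comp (by fun_prop)
  have j2 : Integrable (Function.uncurry fun (p r : ℂ × ℝ) => hsK 4 s (1/4) p * hsK 4 s (1/4) (hsSh ξ p r) * φ (r.1, r.2 + τ))
    ((volume.prod volume).prod (volume.prod volume)) := by
    refine j1.mul_bdd (c := M) ?_ ?_
    · exact (hφm.comp measurable_snd).aestronglyMeasurable
    · exact Eventually.of_forall fun q => hM _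
  have e1 : ∀ p : ℂ × ℝ, ∫ q : ℂ × ℝ, hsK 4 s (1/4) p * (hsK 4 s (1/4) q *
      φ (p.1 + ξ + q.1, p.2 + τ + q.2 + (hsω p.1 ξ + hsω (p.1 + ξ) q.1) / 2)) ∂(volume.prod volume)
      = ∫ r : ℂ × ℝ, hsK 4 s (1/4) p * hsK 4 s (1/4) (hsSh ξ p r) * φ (r.1, r.2 + τ) ∂(volume.prod volume) := by
    intro p
    have hm : Measurable fun q : ℂ × ℝ => hsK 4 s (1/4) p * (hsK 4 s (1/4) q *
      φ (p.1 + ξ + q.1, p.2 + τ + q.2 + (hsω p.1 ξ + hsω (p.1 + ξ) q.1) / 2)) := by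
      refine (hKc.measurable.mul (hφ.comp ?_)).const_mul _
      unfold hsω; fun_prop
    rw [← (hsSh_mp ξ p).map_eq, integral_map (hsSh_mp ξ p).aemeasurable hm.aestronglyMeasurable, (hsSh_mp ξ p).map_eq]
    congr 1
    funext r
    rw [mul_assoc]
    congr 4
    · simp only [hsSh]; ring
    · simp only [hsSh, hsω, Complex.add_re, Complex.add_im, Complex.sub_re, Complex.sub_im, Complex.neg_re, Complex.neg_im]; ring
  simp_rw [e1]
  rw [integral_integral_swap j2]
  refine integral_congr_ae ?_
  filter_upwards [j1.prod_left_ae] with r hr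
  rw [integral_mul_const, hs_conv_ker s hs ξ r hr]
end HsPart5

section HsPart6
open Filter Topology MeasureTheory Set

lemma hs_xi (s κ ε : ℝ) (hs : 0 < s) (hκ : 0 < κ) (hε : 0 < ε) (p : ℂ × ℝ) :
    ∫ ξ : ℂ, hsK 4 (s + ε * ‖ξ‖ ^ 2) κ (p.1, p.2 - hsω p.1 ξ) =
      (Real.pi / (ε * ((2 : ℕ) + 1)) : ℂ) * hsK 3 s (κ + 1 / (4 * ε)) p := by
  obtain ⟨z, t⟩ := p
  have inn : ∀ a b : ℂ, (inner ℝ a b : ℝ) = a.re * b.re + a.im * b.im := by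
    intro a b; simp [Complex.inner]; ring
  have hp := hs_planar 2 (((s + κ * ‖z‖ ^ 2 : ℝ) : ℂ) + Complex.I * t)
    (by simp [-Complex.ofReal_add]; positivity) ε hε (- (Complex.I * z))
  have e : ∀ ξ : ℂ, hsK 4 (s + ε * ‖ξ‖ ^ 2) κ (z, t - hsω z ξ) = 1 / (((s + κ * ‖z‖ ^ 2 : ℝ) : ℂ) + Complex.I * t
     + ε * ‖ξ‖ ^ 2 + Complex.I * (inner ℝ (- (Complex.I * z)) ξ : ℝ)) ^ (2 + 2) := by
    intro ξ
    simp only [hsK]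
    congr 2
    rw [inn]
    simp [hsω]
    ring
  simp_rw [e]
  rw [hp]
  congr 1
  simp only [hsK]
  congr 2
  rw [norm_neg, norm_mul, Complex.norm_I, one_mul]
  push_cast
  ring

lemma hs_ex1 (φ : ℂ × ℝ → ℂ) (hφ : Measurable φ) (M : ℝ) (hM : ∀ p, ‖φ p‖ ≤ M)
    (h : ∀ s > 0, ∀ ξ : ℂ, ∫ p, hsK 4 s (1/4) p * φ (p.1, p.2 + hsω p.1 ξ) ∂(volume.prod volume) = 0)
    (s ε : ℝ) (hs : 0 < s) (hε : 0 < ε) :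
    ∫ p, hsK 3 s (1/4 + 1 / (4 * ε)) p * φ p ∂(volume.prod volume) = 0 := by
  have mp : ∀ ξ : ℂ, MeasurePreserving (fun p : ℂ × ℝ => (p.1, p.2 - hsω p.1 ξ)) (volume.prod volume) (volume.prod volume) := by
    intro ξ
    have := hs_shear 0 (fun z => - hsω z ξ) (by unfold hsω; fun_prop)
    simpa [sub_eq_add_neg] using this
  have mp2 : MeasurePreserving (fun q : ℂ × (ℂ × ℝ) => (q.1, (q.2.1, q.2.2 - hsω q.2.1 q.1)))
      (volume.prod (volume.prod volume)) (volume.prod (volume.prod volume)) := by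
    refine (MeasurePreserving.id _).skew_product (g := fun ξ (p : ℂ × ℝ) => (p.1, p.2 - hsω p.1 ξ)) ?_
      (Eventually.of_forall fun ξ => (mp ξ).map_eq)
    simp only [Function.uncurry_def]; unfold hsω; fun_prop
  have j1 : Integrable (Function.uncurry fun (ξ : ℂ) (p : ℂ × ℝ) => hsK 4 (s + ε * ‖ξ‖ ^ 2) (1/4) (p.1, p.2 - hsω p.1 ξ) * φ p)
     (volume.prod (volume.prod volume)) := by
    refine Integrable.mul_bdd (c := M) (mp2.integrable_comp_of_integrable (hs_ker_int4' s (1/4) ε hs (by norm_num) hε)) ?_ ?_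
    · exact (hφ.comp measurable_snd).aestronglyMeasurable
    · exact Eventually.of_forall fun q => hM _
  have e1 : ∀ ξ : ℂ, ∫ p, hsK 4 (s + ε * ‖ξ‖ ^ 2) (1/4) (p.1, p.2 - hsω p.1 ξ) * φ p ∂(volume.prod volume) = 0 := by
    intro ξ
    have hs' : 0 < s + ε * ‖ξ‖ ^ 2 := by positivity
    rw [← h _ hs' ξ]
    nth_rewrite 2 [← (mp ξ).map_eq]
    rw [integral_map (mp ξ).aemeasurable]
    · simp
    · refine Measurable.aestronglyMeasurable ?_
      refine (hs_ker_cont 4 _ _ hs' (by norm_num)).measurable.mul (hφ.comp ?_)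
      unfold hsω; fun_prop
  have e2 := integral_integral_swap j1
  simp_rw [e1] at e2
  simp_rw [integral_mul_const, hs_xi s (1/4) ε hs (by norm_num) hε, mul_assoc] at e2
  rw [integral_const_mul, integral_zero] at e2
  refine (mul_eq_zero.1 e2.symm).resolve_left ?_
  have : (Real.pi : ℂ) ≠ 0 := by exact_mod_cast Real.pi_ne_zero
  have : (ε : ℂ) ≠ 0 := by exact_mod_cast hε.ne'
  have h3 : ((2 : ℕ) + 1 : ℂ) ≠ 0 := by norm_num
  positivity

lemma hs_ex2 (φ : ℂ × ℝ → ℂ) (hφ : Measurable φ) (M : ℝ) (hM : ∀ p, ‖φ p‖ ≤ M)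
    (h : ∀ s > 0, ∀ ξ : ℂ, ∫ p, hsK 4 s (1/4) p * φ (p.1, p.2 + hsω p.1 ξ) ∂(volume.prod volume) = 0)
    (hc : ∀ (ρ : ℂ) (t : ℝ), Continuous fun x : ℝ => φ (x • ρ, t))
    (s : ℝ) (hs : 0 < s) :
    ∫ t : ℝ, 1 / ((s : ℂ) + Complex.I * t) ^ 2 * φ (0, t) = 0 := by
  have hK := hs_ker_int3 s 1 hs one_pos
  have bd : ∀ R : ℝ, Integrable (fun p : ℂ × ℝ => hsK 3 s 1 p * φ (R • p.1, p.2)) (volume.prod volume) := by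
    intro R
    refine hK.mul_bdd (c := M) ?_ (Eventually.of_forall fun q => hM _)
    exact (hφ.comp (by fun_prop)).aestronglyMeasurable
  have z1 : ∀ R : ℝ, 0 < R → R ≤ 1 → ∫ p : ℂ × ℝ, hsK 3 s 1 p * φ (R • p.1, p.2) ∂(volume.prod volume) = 0 := by
    intro R hR hR1
    have hk1 : 1 ≤ (R ^ 2)⁻¹ := by
      rw [one_le_inv₀ (by positivity)]
      nlinarith
    have hε : 0 < 1 / (4 * ((R ^ 2)⁻¹ - 1 / 4)) := by
      apply div_pos one_pos; linarith
    have h0 := hs_ex1 φ hφ M hM h s _ hs hε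
    have hκ : (1/4 + 1 / (4 * (1 / (4 * ((R ^ 2)⁻¹ - 1 / 4))))) = (R ^ 2)⁻¹ := by
      have : (4 * ((R ^ 2)⁻¹ - 1 / 4)) ≠ 0 := by
        apply ne_of_gt; linarith
      rw [mul_one_div, one_div_div]; ring
    rw [hκ] at h0
    have hi : Integrable (fun p : ℂ × ℝ => hsK 3 s (R ^ 2)⁻¹ p * φ p) (volume.prod volume) :=
      (hs_ker_int3 s _ hs (by positivity)).mul_bdd (c := M) hφ.aestronglyMeasurable (Eventually.of_forall fun q => hM _)
    rw [integral_prod _ hi] at h0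
    have h1 := Measure.integral_comp_smul volume (fun z : ℂ => ∫ t : ℝ, hsK 3 s (R ^ 2)⁻¹ (z, t) * φ (z, t)) R
    rw [h0, smul_zero] at h1
    rw [integral_prod _ (bd R), ← h1]
    congr 1; funext z
    congr 1; funext t
    congr 1
    simp only [hsK]
    congr 3
    rw [norm_smul, Real.norm_of_nonneg hR.le]
    have : (R : ℂ) ≠ 0 := by exact_mod_cast hR.ne'
    push_cast
    field_simp
  have lim : Tendsto (fun j : ℕ => ∫ p : ℂ × ℝ, hsK 3 s 1 p * φ ((1 / ((j : ℝ) + 1)) • p.1, p.2) ∂(volume.prod volume)) atTop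
      (𝓝 (∫ p : ℂ × ℝ, hsK 3 s 1 p * φ ((0 : ℝ) • p.1, p.2) ∂(volume.prod volume))) := by
    refine tendsto_integral_of_dominated_convergence (fun p => ‖hsK 3 s 1 p‖ * M) (fun j => (bd _).aestronglyMeasurable)
      (hK.norm.mul_const M) (fun j => Eventually.of_forall fun p => ?_) (Eventually.of_forall fun p => ?_)
    · rw [norm_mul]
      exact mul_le_mul_of_nonneg_left (hM _) (norm_nonneg _)
    · refine Tendsto.const_mul _ ?_
      exact ((hc p.1 p.2).tendsto 0).comp tendsto_one_div_add_atTop_nhds_zero_nat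
  have z2 : ∫ p : ℂ × ℝ, hsK 3 s 1 p * φ ((0 : ℝ) • p.1, p.2) ∂(volume.prod volume) = 0 := by
    refine tendsto_nhds_unique lim ?_
    refine tendsto_const_nhds.congr fun j => (z1 _ (by positivity) ?_).symm
    rw [div_le_one (by positivity)]
    linarith [(Nat.cast_nonneg j : (0:ℝ) ≤ j)]
  rw [integral_prod_symm _ (bd 0)] at z2
  have e3 : ∀ t : ℝ, ∫ z : ℂ, hsK 3 s 1 (z, t) = (Real.pi / (((1:ℝ):ℂ) * ((1 : ℕ) + 1)) : ℂ) * (1 / ((s : ℂ) + Complex.I * t) ^ 2) := by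
    intro t
    have := hs_planar 1 ((s : ℂ) + Complex.I * t) (by simpa using hs) 1 one_pos 0
    simp only [norm_zero, inner_zero_left] at this
    have h2 : ((s : ℂ) + Complex.I * t) + ((0:ℝ):ℂ) ^ 2 / (4 * ((1:ℝ):ℂ)) = (s : ℂ) + Complex.I * t := by simp
    rw [h2] at this
    rw [← this]
    congr 1; funext z
    simp only [hsK]
    congr 2
    push_cast; ring
  simp_rw [zero_smul, integral_mul_const, e3, mul_assoc] at z2
  rw [integral_const_mul] at z2
  refine (mul_eq_zero.1 z2).resolve_left ?_
  have : (Real.pi : ℂ) ≠ 0 := by exact_mod_cast Real.pi_ne_zero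
  norm_num [this]
end HsPart6

section HsPart7
open Filter Topology MeasureTheory Set

lemma hs_pois_int (s : ℝ) (hs : 0 < s) : Integrable fun t : ℝ => (s ^ 2 + t ^ 2)⁻¹ := by
  have := (integrable_inv_one_add_sq.comp_div hs.ne').const_mul ((s ^ 2)⁻¹)
  refine this.congr (Eventually.of_forall fun t => ?_)
  simp only []
  rw [← mul_inv]
  congr 1
  field_simp

noncomputable def hsJ (F : ℝ → ℂ) (s : ℝ) : ℂ := ∫ t : ℝ, ((s * (s ^ 2 + t ^ 2)⁻¹ : ℝ) : ℂ) * F t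

lemma hs_J_scale (F : ℝ → ℂ) (s : ℝ) (hs : 0 < s) :
    hsJ F s = ∫ x : ℝ, (((1 + x ^ 2)⁻¹ : ℝ) : ℂ) * F (s * x) := by
  have h := Measure.integral_comp_mul_left (fun t : ℝ => ((s * (s ^ 2 + t ^ 2)⁻¹ : ℝ) : ℂ) * F t) s
  have hsJ' : hsJ F s = (s : ℂ) * ∫ x : ℝ, ((s * (s ^ 2 + (s * x) ^ 2)⁻¹ : ℝ) : ℂ) * F (s * x) := by
    rw [h, abs_of_pos (by positivity), Complex.real_smul]
    have : (s : ℂ) ≠ 0 := by exact_mod_cast hs.ne'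
    unfold hsJ
    generalize (∫ t : ℝ, ((s * (s ^ 2 + t ^ 2)⁻¹ : ℝ) : ℂ) * F t) = Z
    push_cast
    field_simp
  rw [hsJ', ← integral_const_mul]
  congr 1; funext x
  rw [← mul_assoc]
  congr 1
  rw [← Complex.ofReal_mul]
  congr 1
  field_simp

lemma hs_J_zero (F : ℝ → ℂ) (hF : Continuous F) (M : ℝ) (hM : ∀ t, ‖F t‖ ≤ M) :
    Tendsto (fun j : ℕ => hsJ F (1 / ((j : ℝ) + 1))) atTop (𝓝 (Real.pi * F 0)) := by
  have e : (Real.pi * F 0 : ℂ) = ∫ x : ℝ, (((1 + x ^ 2)⁻¹ : ℝ) : ℂ) * F (0 * x) := by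
    simp_rw [zero_mul]
    rw [integral_mul_const, integral_complex_ofReal, integral_univ_inv_one_add_sq]
  rw [e]
  have : ∀ j : ℕ, hsJ F (1 / ((j : ℝ) + 1)) = ∫ x : ℝ, (((1 + x ^ 2)⁻¹ : ℝ) : ℂ) * F ((1 / ((j : ℝ) + 1)) * x) :=
    fun j => hs_J_scale F _ (by positivity)
  simp_rw [this]
  have hc : Continuous fun x : ℝ => (((1 + x ^ 2)⁻¹ : ℝ) : ℂ) := by
    refine Complex.continuous_ofReal.comp (Continuous.inv₀ (by fun_prop) fun x => by positivity)
  refine tendsto_integral_of_dominated_convergence (fun x => (1 + x ^ 2)⁻¹ * M)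
    (fun j => (hc.mul (by fun_prop)).aestronglyMeasurable)
    (integrable_inv_one_add_sq.mul_const M) (fun j => Eventually.of_forall fun x => ?_) (Eventually.of_forall fun x => ?_)
  · rw [norm_mul, Complex.norm_real, Real.norm_of_nonneg (by positivity)]
    exact mul_le_mul_of_nonneg_left (hM _) (by positivity)
  · refine Tendsto.const_mul _ ?_
    exact (((hF.comp (continuous_mul_const x))).tendsto 0).comp tendsto_one_div_add_atTop_nhds_zero_nat

lemma hs_J_deriv (F : ℝ → ℂ) (hF : Continuous F) (M : ℝ) (hM : ∀ t, ‖F t‖ ≤ M) (s : ℝ) (hs : 0 < s) :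
    HasDerivAt (hsJ F) (∫ t : ℝ, (((t ^ 2 - s ^ 2) * ((s ^ 2 + t ^ 2) ^ 2)⁻¹ : ℝ) : ℂ) * F t) s := by
  have hM0 : 0 ≤ M := (norm_nonneg _).trans (hM 0)
  have cm : ∀ x : ℝ, 0 < x → Continuous fun t : ℝ => ((x * (x ^ 2 + t ^ 2)⁻¹ : ℝ) : ℂ) * F t := by
    intro x hx
    refine (Complex.continuous_ofReal.comp ?_).mul hF
    exact continuous_const.mul (Continuous.inv₀ (by fun_prop) fun t => by positivity)
  have pos : ∀ x ∈ Ioi (s / 2), 0 < x := fun x hx => lt_trans (by positivity) hx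
  refine (hasDerivAt_integral_of_dominated_loc_of_deriv_le
    (F := fun s t => ((s * (s ^ 2 + t ^ 2)⁻¹ : ℝ) : ℂ) * F t)
    (F' := fun s t => (((t ^ 2 - s ^ 2) * ((s ^ 2 + t ^ 2) ^ 2)⁻¹ : ℝ) : ℂ) * F t)
    (s := Ioi (s / 2)) (bound := fun t => ((s / 2) ^ 2 + t ^ 2)⁻¹ * M) (Ioi_mem_nhds (by linarith)) ?_ ?_ ?_ ?_ ?_ ?_).2
  · filter_upwards [Ioi_mem_nhds hs] with x hx
    exact (cm x hx).aestronglyMeasurable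
  · refine ((hs_pois_int s hs).const_mul (s * M)).mono' (cm s hs).aestronglyMeasurable (Eventually.of_forall fun t => ?_)
    rw [norm_mul, Complex.norm_real, Real.norm_of_nonneg (by positivity)]
    calc _ ≤ s * (s ^ 2 + t ^ 2)⁻¹ * M := mul_le_mul_of_nonneg_left (hM _) (by positivity)
      _ = _ := by ring
  · refine Continuous.aestronglyMeasurable ((Complex.continuous_ofReal.comp ?_).mul hF)
    exact Continuous.mul (by fun_prop) (Continuous.inv₀ (by fun_prop) fun t => by positivity)
  · refine Eventually.of_forall fun t x hx => ?_
    have hx0 := pos x hx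
    rw [norm_mul, Complex.norm_real]
    refine mul_le_mul ?_ (hM t) (norm_nonneg _) (by positivity)
    have h1 : ‖(t ^ 2 - x ^ 2) * ((x ^ 2 + t ^ 2) ^ 2)⁻¹‖ ≤ (x ^ 2 + t ^ 2)⁻¹ := by
      rw [norm_mul, Real.norm_eq_abs, norm_inv, norm_pow, Real.norm_of_nonneg (by positivity : 0 ≤ x ^ 2 + t ^ 2)]
      have : |t ^ 2 - x ^ 2| ≤ x ^ 2 + t ^ 2 := abs_le.2 ⟨by nlinarith, by nlinarith⟩
      rw [← div_eq_mul_inv, div_le_iff₀ (by positivity), pow_two (x ^ 2 + t ^ 2), ← mul_assoc, inv_mul_cancel₀ (by positivity), one_mul]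
      exact this
    refine h1.trans ?_
    have : s / 2 ≤ x := le_of_lt hx
    gcongr
  · exact (hs_pois_int _ (by positivity)).mul_const M
  · refine Eventually.of_forall fun t x hx => ?_
    have hx0 := pos x hx
    refine HasDerivAt.mul_const ?_ _
    refine HasDerivAt.ofReal_comp (f := fun x => x * (x ^ 2 + t ^ 2)⁻¹) ?_
    have h1 : HasDerivAt (fun x : ℝ => x ^ 2 + t ^ 2) (2 * x) x := by
      simpa using (hasDerivAt_pow 2 x).add_const (t ^ 2)
    have h2 := (hasDerivAt_id x).mul (h1.inv (by positivity))
    refine h2.congr_deriv ?_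
    simp only [id]
    have : x ^ 2 + t ^ 2 ≠ 0 := by positivity
    simp only [Pi.inv_apply]
    field_simp
    ring

lemma hs_J_const (F : ℝ → ℂ) (hF : Continuous F) (M : ℝ) (hM : ∀ t, ‖F t‖ ≤ M)
    (h1 : ∀ s : ℝ, 0 < s → ∫ t : ℝ, 1 / ((s : ℂ) + Complex.I * t) ^ 2 * F t = 0)
    (h2 : ∀ s : ℝ, 0 < s → ∫ t : ℝ, 1 / ((s : ℂ) - Complex.I * t) ^ 2 * F t = 0) (s : ℝ) (hs : 0 < s) :
    hsJ F s = Real.pi * F 0 := by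
  have d0 : ∀ s : ℝ, 0 < s → ∫ t : ℝ, (((t ^ 2 - s ^ 2) * ((s ^ 2 + t ^ 2) ^ 2)⁻¹ : ℝ) : ℂ) * F t = 0 := by
    intro s hs
    have i1 : Integrable fun t : ℝ => 1 / ((s : ℂ) + Complex.I * t) ^ 2 * F t :=
      (hs_int_line 0 s (by simpa using hs)).mul_bdd (c := M) hF.aestronglyMeasurable (Eventually.of_forall hM)
    have i2 : Integrable fun t : ℝ => 1 / ((s : ℂ) - Complex.I * t) ^ 2 * F t := by
      refine Integrable.mul_bdd (c := M) ?_ hF.aestronglyMeasurable (Eventually.of_forall hM)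
      refine (hs_int_line 0 s (by simpa using hs)).comp_neg.congr (Eventually.of_forall fun t => ?_)
      simp only []
      push_cast
      congr 2; ring
    have i3 := integral_add i1 i2
    rw [h1 s hs, h2 s hs, add_zero] at i3
    have : ∀ t : ℝ, 1 / ((s : ℂ) + Complex.I * t) ^ 2 * F t + 1 / ((s : ℂ) - Complex.I * t) ^ 2 * F t
       = (-2 : ℂ) * ((((t ^ 2 - s ^ 2) * ((s ^ 2 + t ^ 2) ^ 2)⁻¹ : ℝ) : ℂ) * F t) := by
      intro t
      rw [← add_mul, ← mul_assoc]
      congr 1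
      have n1 : (s : ℂ) + Complex.I * t ≠ 0 := by
        intro h; have := congrArg Complex.re h; simp at this; linarith
      have n2 : (s : ℂ) - Complex.I * t ≠ 0 := by
        intro h; have := congrArg Complex.re h; simp at this; linarith
      have n3 : (s : ℂ) ^ 2 + t ^ 2 = (s + Complex.I * t) * (s - Complex.I * t) := by
        ring_nf; rw [Complex.I_sq]; ring
      push_cast
      rw [n3, mul_pow]
      field_simp
      ring_nf; rw [Complex.I_sq]; ring
    simp_rw [this] at i3
    rw [integral_const_mul] at i3
    exact (mul_eq_zero.1 i3).resolve_left (by norm_num)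
  have cst : ∀ x ∈ Ioi (0:ℝ), ∀ y ∈ Ioi (0:ℝ), hsJ F x = hsJ F y := by
    intro x hx y hy
    refine isOpen_Ioi.is_const_of_deriv_eq_zero (convex_Ioi 0).isPreconnected
      (fun z hz => (hs_J_deriv F hF M hM z hz).differentiableAt.differentiableWithinAt) (fun z hz => ?_) hx hy
    rw [(hs_J_deriv F hF M hM z hz).deriv, d0 z hz]; rfl
  refine tendsto_nhds_unique ?_ (hs_J_zero F hF M hM)
  refine tendsto_const_nhds.congr fun j => cst _ hs _ ?_
  simp only [mem_Ioi]; positivity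

lemma hs_lor (x e : ℝ) : ‖(1 + (x - e) ^ 2)⁻¹ - (1 + x ^ 2)⁻¹‖ ≤ |e| / 2 * ((1 + (x - e) ^ 2)⁻¹ + (1 + x ^ 2)⁻¹) := by
  obtain ⟨y, rfl⟩ : ∃ y, e = x - y := ⟨x - e, by ring⟩
  rw [sub_sub_cancel]
  have h1 : 0 < 1 + y ^ 2 := by positivity
  have h2 : 0 < 1 + x ^ 2 := by positivity
  rw [inv_sub_inv h1.ne' h2.ne', inv_add_inv h1.ne' h2.ne', norm_div, Real.norm_eq_abs,
    Real.norm_of_nonneg (by positivity), mul_div_assoc']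
  apply div_le_div_of_nonneg_right _ (by positivity)
  have e : 1 + x ^ 2 - (1 + y ^ 2) = (x - y) * (x + y) := by ring
  rw [e, abs_mul, div_mul_eq_mul_div, mul_div_assoc]
  apply mul_le_mul_of_nonneg_left _ (abs_nonneg _)
  rw [abs_le]
  constructor <;> nlinarith [sq_nonneg (x - 1), sq_nonneg (x + 1), sq_nonneg (y - 1), sq_nonneg (y + 1)]

lemma hs_fixed (F : ℝ → ℂ) (hF : Continuous F) (M : ℝ) (hM : ∀ t, ‖F t‖ ≤ M)
    (h1 : ∀ t₀ : ℝ, ∀ s : ℝ, 0 < s → ∫ t : ℝ, 1 / ((s : ℂ) + Complex.I * t) ^ 2 * F (t + t₀) = 0)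
    (h2 : ∀ t₀ : ℝ, ∀ s : ℝ, 0 < s → ∫ t : ℝ, 1 / ((s : ℂ) - Complex.I * t) ^ 2 * F (t + t₀) = 0) (t₀ : ℝ) :
    F t₀ = F 0 := by
  have hM0 : 0 ≤ M := (norm_nonneg _).trans (hM 0)
  have a : ∀ t₀ s : ℝ, 0 < s → ∫ x : ℝ, (((1 + x ^ 2)⁻¹ : ℝ) : ℂ) * F (s * x + t₀) = Real.pi * F t₀ := by
    intro t₀ s hs
    have := hs_J_const (fun t => F (t + t₀)) (by fun_prop) M (fun t => hM _) (h1 t₀) (h2 t₀) s hs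
    rw [hs_J_scale _ s hs] at this
    simpa using this
  have cc : Continuous fun x : ℝ => (((1 + x ^ 2)⁻¹ : ℝ) : ℂ) := by
    refine Complex.continuous_ofReal.comp (Continuous.inv₀ (by fun_prop) fun x => by positivity)
  have ii := integrable_inv_one_add_sq
  have key : ∀ s : ℝ, 0 < s → ‖(Real.pi * F t₀ - Real.pi * F 0 : ℂ)‖ ≤ |t₀| * Real.pi * M * s⁻¹ := by
    intro s hs
    set e := t₀ / s with he
    have b0 := a 0 s hs
    have b1 := a t₀ s hs
    have b2 : ∫ x : ℝ, (((1 + (x - e) ^ 2)⁻¹ : ℝ) : ℂ) * F (s * x) = Real.pi * F t₀ := by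
      rw [← b1, ← integral_add_right_eq_self _ e]
      congr 1; funext x
      rw [add_sub_cancel_right]
      congr 2
      rw [he]; field_simp
    simp only [add_zero] at b0
    have i1 : Integrable fun x : ℝ => (((1 + (x - e) ^ 2)⁻¹ : ℝ) : ℂ) * F (s * x) :=
      (ii.comp_sub_right e).ofReal.mul_bdd (c := M) (by fun_prop) (Eventually.of_forall fun _ => hM _)
    have i2 : Integrable fun x : ℝ => (((1 + x ^ 2)⁻¹ : ℝ) : ℂ) * F (s * x) :=
      ii.ofReal.mul_bdd (c := M) (by fun_prop) (Eventually.of_forall fun _ => hM _)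
    rw [← b0, ← b2, ← integral_sub i1 i2]
    have bi : Integrable fun x : ℝ => |e| / 2 * ((1 + (x - e) ^ 2)⁻¹ + (1 + x ^ 2)⁻¹) * M :=
      (((ii.comp_sub_right e).add ii).const_mul _).mul_const M
    refine (norm_integral_le_of_norm_le bi (Eventually.of_forall fun x => ?_)).trans (le_of_eq ?_)
    · rw [← sub_mul, norm_mul, ← Complex.ofReal_sub, Complex.norm_real]
      refine mul_le_mul ?_ (hM _) (norm_nonneg _) (by positivity)
      exact hs_lor x e
    · rw [integral_mul_const, integral_const_mul, integral_add (ii.comp_sub_right e) ii,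
        integral_sub_right_eq_self (fun x : ℝ => (1 + x ^ 2)⁻¹) e, integral_univ_inv_one_add_sq, he, abs_div, abs_of_pos hs]
      field_simp
      ring
  have lim : Tendsto (fun s : ℝ => |t₀| * Real.pi * M * s⁻¹) atTop (𝓝 (|t₀| * Real.pi * M * 0)) :=
    tendsto_inv_atTop_zero.const_mul _
  have h0 : ‖(Real.pi * F t₀ - Real.pi * F 0 : ℂ)‖ ≤ |t₀| * Real.pi * M * 0 :=
    ge_of_tendsto lim ((eventually_gt_atTop 0).mono key)
  rw [mul_zero, norm_le_zero_iff, ← mul_sub] at h0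
  have : (Real.pi : ℂ) ≠ 0 := by exact_mod_cast Real.pi_ne_zero
  exact sub_eq_zero.1 ((mul_eq_zero.1 h0).resolve_left this)
end HsPart7

section HsPart8
open Filter Topology MeasureTheory Set
open scoped InnerProductSpace
set_option linter.unusedSectionVars false

structure HsRep (H : Type*) [NormedAddCommGroup H] [InnerProductSpace ℂ H] where
  V : ℂ × ℝ → H →ₗᵢ[ℂ] H
  zero : ∀ v, V (0, 0) v = v
  mul : ∀ p q v, V p (V q v) = V (p.1 + q.1, p.2 + q.2 + hsω p.1 q.1 / 2) v
  meas : ∀ v w, Measurable fun p => ⟪w, V p v⟫_ℂ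

namespace HsRep
variable {H : Type*} [NormedAddCommGroup H] [InnerProductSpace ℂ H] [CompleteSpace H]
  [SecondCountableTopology H] (ρ : HsRep H)

lemma neg_mul (p : ℂ × ℝ) (v : H) : ρ.V (-p) (ρ.V p v) = v := by
  rw [ρ.mul]
  have : hsω (-p).1 p.1 = 0 := by simp [hsω]; ring
  rw [this]; simpa using ρ.zero v

lemma inner_adj (p : ℂ × ℝ) (v w : H) : ⟪ρ.V p v, w⟫_ℂ = ⟪v, ρ.V (-p) w⟫_ℂ := by
  rw [← (ρ.V (-p)).inner_map_map, ρ.neg_mul]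

lemma inner_adj' (p : ℂ × ℝ) (v w : H) : ⟪ρ.V (-p) v, w⟫_ℂ = ⟪v, ρ.V p w⟫_ℂ := by
  rw [inner_adj, neg_neg]

lemma meas_norm (v y : H) : Measurable fun p => ‖ρ.V p v - y‖ := by
  have : ∀ p, ‖ρ.V p v - y‖ = √(‖v‖ ^ 2 - 2 * (⟪y, ρ.V p v⟫_ℂ).re + ‖y‖ ^ 2) := by
    intro p
    rw [← Real.sqrt_sq (norm_nonneg (ρ.V p v - y)), @norm_sub_sq ℂ, ← inner_conj_symm y, Complex.conj_re]
    simp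
  simp_rw [this]
  have := ρ.meas v y
  fun_prop

lemma smeas (v : H) : StronglyMeasurable fun p => ρ.V p v := by
  borelize H
  refine Measurable.stronglyMeasurable ?_
  refine measurable_of_isOpen fun O hO => ?_
  obtain ⟨T, hT, hTc, hTe⟩ := TopologicalSpace.isOpen_biUnion_countable {q : H × ℝ | Metric.ball q.1 q.2 ⊆ O}
    (fun q => Metric.ball q.1 q.2) (fun q _ => Metric.isOpen_ball)
  have hO' : O = ⋃ i ∈ T, Metric.ball i.1 i.2 := by
    rw [hTe]
    apply subset_antisymm
    · intro x hx
      obtain ⟨ε, hε, hb⟩ := Metric.isOpen_iff.1 hO x hx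
      exact mem_biUnion (show (x, ε) ∈ {q : H × ℝ | Metric.ball q.1 q.2 ⊆ O} from hb) (Metric.mem_ball_self hε)
    · exact iUnion₂_subset fun q hq => hq
  rw [hO', preimage_iUnion₂]
  refine MeasurableSet.biUnion hTc fun q _ => ?_
  have : (fun p => ρ.V p v) ⁻¹' Metric.ball q.1 q.2 = {p | ‖ρ.V p v - q.1‖ < q.2} := by
    ext p; simp [dist_eq_norm]
  rw [this]
  exact measurableSet_lt (ρ.meas_norm v q.1) measurable_const

lemma cont_aux (R : ℝ → H) (hR : ∀ a b, ‖R a - R b‖ = ‖R (a - b) - R 0‖)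
    (hm : ∀ y, Measurable fun s => ‖R s - y‖) : Continuous R := by
  rw [Metric.continuous_iff]
  intro b ε hε
  obtain ⟨D, hDc, hD⟩ := TopologicalSpace.exists_countable_dense H
  have cov : (univ : Set ℝ) ⊆ ⋃ y ∈ D, {s | ‖R s - y‖ < ε / 2} := by
    intro s _
    obtain ⟨y, hy, hd⟩ := Metric.dense_iff.1 hD (R s) (ε / 2) (by positivity)
    refine mem_biUnion hd ?_
    simpa [dist_eq_norm, norm_sub_rev] using hy
  have : ∃ y ∈ D, 0 < volume {s | ‖R s - y‖ < ε / 2} := by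
    by_contra! hh
    have h0 : volume (⋃ y ∈ D, {s | ‖R s - y‖ < ε / 2}) = 0 :=
      (measure_biUnion_null_iff hDc).2 fun y hy => le_antisymm (hh y hy) bot_le
    have := measure_mono_null cov h0
    simp at this
  obtain ⟨y, -, hy⟩ := this
  have hmeas : MeasurableSet {s | ‖R s - y‖ < ε / 2} := measurableSet_lt (hm y) measurable_const
  have nb := Measure.sub_mem_nhds_zero_of_addHaar_pos volume _ hmeas hy
  obtain ⟨δ, hδ, hb⟩ := Metric.mem_nhds_iff.1 nb
  refine ⟨δ, hδ, fun a ha => ?_⟩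
  have : a - b ∈ Metric.ball (0:ℝ) δ := by simpa [dist_eq_norm] using ha
  obtain ⟨x, hx, x', hx', e⟩ := hb this
  simp only [] at e
  rw [dist_eq_norm, hR, ← e, ← hR]
  calc _ = ‖(R x - y) - (R x' - y)‖ := by congr 1; abel
    _ ≤ ‖R x - y‖ + ‖R x' - y‖ := norm_sub_le _ _
    _ < ε / 2 + ε / 2 := add_lt_add hx hx'
    _ = ε := by ring

lemma cont_line (z : ℂ) (v : H) : Continuous fun x : ℝ => ρ.V (x • z, 0) v := by
  refine cont_aux _ (fun a b => ?_) (fun y => ?_)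
  · have h1 : ρ.V (a • z, 0) v = ρ.V (b • z, 0) (ρ.V ((a - b) • z, 0) v) := by
      rw [ρ.mul]
      have : hsω (b • z) ((a - b) • z) = 0 := by simp [hsω]; ring
      simp only [this]
      rw [← add_smul]; simp
    have h2 : ρ.V (b • z, 0) v = ρ.V (b • z, 0) (ρ.V ((0 : ℝ) • z, 0) v) := by
      rw [zero_smul, ρ.zero]
    rw [h1, h2, ← map_sub, LinearIsometry.norm_map]
  · exact (ρ.meas_norm v y).comp (by fun_prop)

lemma cont_center (v : H) : Continuous fun x : ℝ => ρ.V (0, x) v := by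
  refine cont_aux _ (fun a b => ?_) (fun y => ?_)
  · have h1 : ρ.V (0, a) v = ρ.V (0, b) (ρ.V (0, a - b) v) := by
      rw [ρ.mul]
      simp [hsω]
    have h2 : ρ.V (0, b) v = ρ.V (0, b) (ρ.V (0, 0) v) := by
      rw [ρ.zero]
    rw [h1, h2, ← map_sub, LinearIsometry.norm_map, ρ.zero]
  · exact (ρ.meas_norm v y).comp (by fun_prop)

noncomputable def Op (s : ℝ) (w : H) : H := ∫ p, hsK 4 s (1/4) p • ρ.V p w ∂(volume.prod volume)

lemma op_int (s : ℝ) (hs : 0 < s) (w : H) :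
    Integrable (fun p => hsK 4 s (1/4) p • ρ.V p w) (volume.prod volume) := by
  refine (hs_ker_int4 s (1/4) hs (by norm_num)).smul_bdd ‖w‖ (ρ.smeas w).aestronglyMeasurable
    (Eventually.of_forall fun p => ?_)
  simp

lemma op_inner (s : ℝ) (hs : 0 < s) (w u : H) :
    ⟪u, ρ.Op s w⟫_ℂ = ∫ p, hsK 4 s (1/4) p * ⟪u, ρ.V p w⟫_ℂ ∂(volume.prod volume) := by
  unfold Op
  rw [← integral_inner (ρ.op_int s hs w)]
  simp_rw [inner_smul_right]

lemma _root_.hsK_symm (n : ℕ) (s κ : ℝ) (p : ℂ × ℝ) : (starRingEnd ℂ) (hsK n s κ (-p)) = hsK n s κ p := by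
  simp only [hsK]
  simp

lemma op_inner' (s : ℝ) (hs : 0 < s) (w u : H) :
    ⟪ρ.Op s w, u⟫_ℂ = ∫ p, hsK 4 s (1/4) p * ⟪w, ρ.V p u⟫_ℂ ∂(volume.prod volume) := by
  rw [← inner_conj_symm, ρ.op_inner s hs, ← integral_conj]
  rw [← integral_neg_eq_self]
  congr 1; funext p
  rw [map_mul, hsK_symm, inner_conj_symm, ρ.inner_adj']

def Radial (v : H) : Prop := ∀ (z z' : ℂ) (t : ℝ), ‖z‖ = ‖z'‖ → ⟪v, ρ.V (z, t) v⟫_ℂ = ⟪v, ρ.V (z', t) v⟫_ℂ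

lemma op_formula (s : ℝ) (hs : 0 < s) (w : H) (ξ : ℂ) (τ : ℝ) :
    ⟪ρ.Op s w, ρ.V (ξ, τ) (ρ.Op s w)⟫_ℂ =
     ∫ r : ℂ × ℝ, (2 * Real.pi * ((2 * 2 + 2).factorial : ℂ) / ((2+1).factorial : ℂ) ^ 2) *
       (Real.pi / (((1/2 : ℝ) : ℂ) * (((5 : ℕ) : ℂ) + 1)) : ℂ) * hsK 6 (2 * s + ‖ξ‖ ^ 2 / 4) (1/4) r *
        ⟪w, ρ.V (r.1, r.2 + τ) w⟫_ℂ ∂(volume.prod volume) := by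
  rw [← hs_conv s hs ξ τ (fun p => ⟪w, ρ.V p w⟫_ℂ) (ρ.meas w w) (‖w‖ * ‖w‖), op_inner' ρ s hs]
  · congr 1; funext p
    rw [integral_const_mul]
    congr 1
    rw [ρ.mul, ← ρ.inner_adj', ρ.op_inner s hs]
    congr 1; funext q
    rw [ρ.inner_adj', ρ.mul]
    congr 4
    simp only [hsω, Complex.add_re, Complex.add_im]; ring
  · intro p
    refine (norm_inner_le_norm _ _).trans ?_
    simp

lemma op_radial (s : ℝ) (hs : 0 < s) (w : H) : ρ.Radial (ρ.Op s w) := by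
  intro z z' t h
  rw [ρ.op_formula s hs, ρ.op_formula s hs, h]

lemma op_zero_line (w : H) (h : ∀ s : ℝ, 0 < s → ∀ p, ρ.Op s (ρ.V p w) = 0) (w' : H) (t₀ s : ℝ) (hs : 0 < s) :
    ∫ t : ℝ, 1 / ((s : ℂ) + Complex.I * t) ^ 2 * ⟪w', ρ.V (0, t + t₀) w⟫_ℂ = 0 := by
  refine hs_ex2 (fun p => ⟪w', ρ.V (p.1, p.2 + t₀) w⟫_ℂ) ((ρ.meas w w').comp (by fun_prop)) (‖w'‖ * ‖w‖)
    (fun p => (norm_inner_le_norm _ _).trans (by simp)) (fun s hs ξ => ?_) (fun z t => ?_) s hs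
  · have h1 := h s hs (ξ, t₀)
    have h2 := ρ.op_inner s hs (ρ.V (ξ, t₀) w) (ρ.V (ξ, 0) w')
    rw [h1, inner_zero_right] at h2
    rw [h2]
    congr 1; funext p
    rw [ρ.inner_adj, ρ.mul, ρ.mul]
    congr 4
    simp [hsω]; ring
  · have : ∀ x : ℝ, ρ.V (x • z, t + t₀) w = ρ.V (0, t + t₀) (ρ.V (x • z, 0) w) := by
      intro x
      rw [ρ.mul]; simp [hsω]
    simp_rw [this]
    exact Continuous.inner continuous_const ((ρ.V _).continuous.comp (ρ.cont_line z w))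

/-- The conjugate representation. -/
noncomputable def conj : HsRep H where
  V p := ρ.V ((starRingEnd ℂ) p.1, - p.2)
  zero v := by simpa using ρ.zero v
  mul p q v := by
    rw [ρ.mul]
    congr 3
    · simp
    · simp [hsω]; ring
  meas v w := (ρ.meas v w).comp (by
    have : Measurable (starRingEnd ℂ) := Complex.continuous_conj.measurable
    fun_prop)

lemma conj_radial (v : H) (h : ρ.conj.Radial v) : ρ.Radial v := by
  intro z z' t hz
  have := h ((starRingEnd ℂ) z) ((starRingEnd ℂ) z') (-t) (by simpa using hz)
  simpa [conj] using this

lemma op_zero_fixed (w : H) (h : ∀ s : ℝ, 0 < s → ∀ p, ρ.Op s (ρ.V p w) = 0)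
    (h' : ∀ s : ℝ, 0 < s → ∀ p, ρ.conj.Op s (ρ.conj.V p w) = 0) (t : ℝ) : ρ.V (0, t) w = w := by
  refine ext_inner_left ℂ fun w' => ?_
  have := hs_fixed (fun t => ⟪w', ρ.V (0, t) w⟫_ℂ) (Continuous.inner continuous_const (ρ.cont_center w)) (‖w'‖ * ‖w‖)
    (fun p => (norm_inner_le_norm _ _).trans (by simp)) (fun t₀ s hs => ρ.op_zero_line w h w' t₀ s hs)
    (fun t₀ s hs => ?_) t
  · simpa [ρ.zero] using this
  · refine Eq.trans ?_ (ρ.conj.op_zero_line w h' w' (-t₀) s hs)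
    rw [← integral_neg_eq_self]
    congr 1; funext t
    simp only [conj]
    congr 2
    · push_cast; ring
    · simp; ring_nf

lemma op_perp (s : ℝ) (hs : 0 < s) (w u : H) (q : ℂ × ℝ) (h : ∀ p, ⟪u, ρ.V p w⟫_ℂ = 0) (p : ℂ × ℝ) :
    ⟪u, ρ.V p (ρ.Op s (ρ.V q w))⟫_ℂ = 0 := by
  rw [← ρ.inner_adj', ρ.op_inner s hs]
  simp_rw [ρ.inner_adj', ρ.mul, h]
  simp

lemma exists_radial (hfix : ∀ w, (∀ t, ρ.V (0, t) w = w) → ∀ p, ρ.V p w = w) (w : H) (hw : w ≠ 0) :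
    ∃ v, v ≠ 0 ∧ ρ.Radial v ∧ ∀ u, (∀ p, ⟪u, ρ.V p w⟫_ℂ = 0) → ∀ p, ⟪u, ρ.V p v⟫_ℂ = 0 := by
  by_cases h : ∀ s : ℝ, 0 < s → ∀ p, ρ.Op s (ρ.V p w) = 0
  · by_cases h' : ∀ s : ℝ, 0 < s → ∀ p, ρ.conj.Op s (ρ.conj.V p w) = 0
    · refine ⟨w, hw, ?_, fun u hu => hu⟩
      have := hfix w (ρ.op_zero_fixed w h h')
      intro z z' t _
      rw [this, this]
    · push Not at h'
      obtain ⟨s, hs, q, hq⟩ := h'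
      refine ⟨_, hq, ρ.conj_radial _ (ρ.conj.op_radial s hs _), fun u hu p => ?_⟩
      have := ρ.conj.op_perp s hs w u q (fun p => hu _) ((starRingEnd ℂ) p.1, - p.2)
      simpa [conj] using this
  · push Not at h
    obtain ⟨s, hs, q, hq⟩ := h
    exact ⟨_, hq, ρ.op_radial s hs _, fun u hu p => ρ.op_perp s hs w u q hu p⟩

end HsRep
end HsPart8

section HsPart9
open Filter Topology MeasureTheory Set
open scoped InnerProductSpace

lemma hs_dense_of_total {H : Type*} [NormedAddCommGroup H] [InnerProductSpace ℂ H] [CompleteSpace H]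
    {ι : Type*} (x : ι → H) (hx : ∀ u, (∀ a, ⟪u, x a⟫_ℂ = 0) → u = 0) :
    DenseRange (Finsupp.linearCombination ℂ x) := by
  have : Dense ((LinearMap.range (Finsupp.linearCombination ℂ x) : Submodule ℂ H) : Set H) := by
    rw [Submodule.dense_iff_topologicalClosure_eq_top, Submodule.topologicalClosure_eq_top_iff,
      Submodule.eq_bot_iff]
    intro u hu
    refine hx u fun a => ?_
    rw [Submodule.mem_orthogonal'] at hu
    refine hu _ ⟨Finsupp.single a 1, by simp⟩
  rwa [LinearMap.coe_range] at this

lemma hs_glue {H : Type*} [NormedAddCommGroup H] [InnerProductSpace ℂ H] [CompleteSpace H]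
    {ι : Type*} (x y : ι → H) (hx : ∀ u, (∀ a, ⟪u, x a⟫_ℂ = 0) → u = 0)
    (hy : ∀ u, (∀ a, ⟪u, y a⟫_ℂ = 0) → u = 0)
    (hg : ∀ a b, ⟪x a, x b⟫_ℂ = ⟪y a, y b⟫_ℂ) :
    ∃ W : H ≃ₗᵢ[ℂ] H, ∀ a, W (x a) = y a := by
  have hn : ∀ c : ι →₀ ℂ, ‖Finsupp.linearCombination ℂ y (LinearEquiv.refl ℂ (ι →₀ ℂ) c)‖
      = ‖Finsupp.linearCombination ℂ x c‖ := by
    intro c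
    rw [← sq_eq_sq₀ (norm_nonneg _) (norm_nonneg _), ← @inner_self_eq_norm_sq ℂ,
      ← @inner_self_eq_norm_sq ℂ]
    simp only [LinearEquiv.refl_apply, Finsupp.linearCombination_apply, Finsupp.sum]
    simp only [sum_inner, inner_sum, inner_smul_left, inner_smul_right, hg]
  refine ⟨LinearEquiv.extendOfIsometry (LinearEquiv.refl ℂ (ι →₀ ℂ)) (Finsupp.linearCombination ℂ x)
    (Finsupp.linearCombination ℂ y) (hs_dense_of_total x hx) (hs_dense_of_total y hy) hn, fun a => ?_⟩
  have := LinearEquiv.extendOfIsometry_eq (LinearEquiv.refl ℂ (ι →₀ ℂ)) (Finsupp.linearCombination ℂ x)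
    (Finsupp.linearCombination ℂ y) (hs_dense_of_total x hx) (hs_dense_of_total y hy) hn
    (Finsupp.single a 1)
  simpa using this

/-- The flip in symmetric coordinates. -/
def hsθ (p : ℂ × ℝ) : ℂ × ℝ := (⟨p.1.im, p.1.re⟩, -p.2)

namespace HsRep
variable {H : Type*} [NormedAddCommGroup H] [InnerProductSpace ℂ H] [CompleteSpace H]
  [SecondCountableTopology H] (ρ : HsRep H)

def Good (S : Set H) : Prop :=
  (∀ v ∈ S, ρ.Radial v) ∧ ∀ v ∈ S, ∀ v' ∈ S, v ≠ v' → ∀ p, ⟪v', ρ.V p v⟫_ℂ = 0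

lemma perp_symm {u v : H} (h : ∀ p, ⟪u, ρ.V p v⟫_ℂ = 0) (p : ℂ × ℝ) : ⟪v, ρ.V p u⟫_ℂ = 0 := by
  rw [← ρ.inner_adj', ← inner_conj_symm, h, map_zero]

lemma exists_good (hfix : ∀ w, (∀ t, ρ.V (0, t) w = w) → ∀ p, ρ.V p w = w) :
    ∃ S : Set H, ρ.Good S ∧ ∀ u, (∀ v ∈ S, ∀ p, ⟪u, ρ.V p v⟫_ℂ = 0) → u = 0 := by
  obtain ⟨S, hS⟩ := zorn_subset {S : Set H | ρ.Good S} (by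
    intro c hc hch
    refine ⟨⋃₀ c, ⟨?_, ?_⟩, fun s hs => subset_sUnion_of_mem hs⟩
    · rintro v ⟨s, hs, hv⟩
      exact (hc hs).1 v hv
    · rintro v ⟨s, hs, hv⟩ v' ⟨s', hs', hv'⟩ hne
      rcases hch.total hs hs' with h | h
      · exact (hc hs').2 v (h hv) v' hv' hne
      · exact (hc hs).2 v hv v' (h hv') hne)
  refine ⟨S, hS.prop, fun u hu => ?_⟩
  by_contra hne
  obtain ⟨v₀, h0, hr, hp⟩ := ρ.exists_radial hfix u hne
  have h1 : ∀ v ∈ S, ∀ p, ⟪v, ρ.V p v₀⟫_ℂ = 0 := fun v hv =>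
    hp v (ρ.perp_symm (hu v hv))
  have hg : ρ.Good (insert v₀ S) := by
    refine ⟨?_, ?_⟩
    · rintro v (rfl | hv)
      · exact hr
      · exact hS.prop.1 v hv
    · rintro v (rfl | hv) v' (rfl | hv') hne
      · exact absurd rfl hne
      · exact h1 v' hv'
      · exact ρ.perp_symm (h1 v hv)
      · exact hS.prop.2 v hv v' hv' hne
  have hmem : v₀ ∈ S := hS.le_of_ge hg (subset_insert _ _) (mem_insert _ _)
  have := h1 v₀ hmem (0, 0)
  rw [ρ.zero] at this
  exact h0 (inner_self_eq_zero.1 this)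

theorem exists_flip (hfix : ∀ w, (∀ t, ρ.V (0, t) w = w) → ∀ p, ρ.V p w = w)
    (J : H → H) (hJ : ∀ x y, ⟪J x, J y⟫_ℂ = ⟪y, x⟫_ℂ) (hJJ : ∀ x, J (J x) = x)
    (hJV : ∀ p v, J (ρ.V p v) = ρ.V p (J v)) :
    ∃ W : H ≃ₗᵢ[ℂ] H, ∀ p v, W (ρ.V p v) = ρ.V (hsθ p) (W v) := by
  obtain ⟨S, hS, htot⟩ := ρ.exists_good hfix
  have gram : ∀ (v w : H) p q, ⟪ρ.V p v, ρ.V q w⟫_ℂ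
      = ⟪v, ρ.V (q.1 - p.1, q.2 - p.2 - hsω p.1 q.1 / 2) w⟫_ℂ := by
    intro v w p q
    rw [ρ.inner_adj, ρ.mul]
    congr 3
    refine Prod.ext ?_ ?_
    · simp; ring
    · simp [hsω]; ring
  have hx : ∀ u, (∀ a : (ℂ × ℝ) × S, ⟪u, ρ.V a.1 a.2⟫_ℂ = 0) → u = 0 := fun u hu =>
    htot u fun v hv p => hu (p, ⟨v, hv⟩)
  have hJ0 : J 0 = 0 := by
    have := hJ 0 0
    rw [inner_zero_left] at this
    exact inner_self_eq_zero.1 this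
  have hθθ : ∀ p, hsθ (hsθ p) = p := fun p => by simp [hsθ]
  obtain ⟨W, hW⟩ := hs_glue (fun a : (ℂ × ℝ) × S => ρ.V a.1 a.2)
    (fun a : (ℂ × ℝ) × S => ρ.V (hsθ a.1) (J a.2)) hx (by
      intro u hu
      have : J u = 0 := htot _ fun v hv p => by
        have := hu (hsθ p, ⟨v, hv⟩)
        simp only [hθθ] at this
        rw [← hJV, ← hJJ u, hJ] at this
        rw [← inner_conj_symm, this, map_zero]
      rw [← hJJ u, this, hJ0]) (by
      rintro ⟨p, v, hv⟩ ⟨q, w, hw⟩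
      simp only
      rw [← hJV, ← hJV, hJ, gram, gram]
      by_cases hvw : v = w
      · subst hvw
        have e : (hsθ p).2 - (hsθ q).2 - hsω (hsθ q).1 (hsθ p).1 / 2 = q.2 - p.2 - hsω p.1 q.1 / 2 := by
          simp [hsθ, hsω]; ring
        rw [e]
        refine hS.1 v hv _ _ _ ?_
        rw [← sq_eq_sq₀ (norm_nonneg _) (norm_nonneg _), ← Complex.normSq_eq_norm_sq,
          ← Complex.normSq_eq_norm_sq, Complex.normSq_apply, Complex.normSq_apply]
        simp [hsθ]; ring
      · rw [hS.2 w hw v hv (Ne.symm hvw), hS.2 v hv w hw hvw])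
  refine ⟨W, fun p => ?_⟩
  have hd := hs_dense_of_total _ hx
  have : ∀ c : ((ℂ × ℝ) × S) →₀ ℂ,
      W (ρ.V p (Finsupp.linearCombination ℂ (fun a : (ℂ × ℝ) × S => ρ.V a.1 a.2) c))
      = ρ.V (hsθ p) (W (Finsupp.linearCombination ℂ (fun a : (ℂ × ℝ) × S => ρ.V a.1 a.2) c)) := by
    intro c
    simp only [Finsupp.linearCombination_apply, Finsupp.sum, map_sum, map_smul]
    refine Finset.sum_congr rfl fun a _ => ?_
    congr 1
    have h1 : W (ρ.V a.1 a.2) = ρ.V (hsθ a.1) (J a.2) := hW a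
    rw [h1, ρ.mul, ρ.mul]
    have h2 : W (ρ.V (p.1 + a.1.1, p.2 + a.1.2 + hsω p.1 a.1.1 / 2) a.2) = _ := hW ((p.1 + a.1.1, p.2 + a.1.2 + hsω p.1 a.1.1 / 2), a.2)
    rw [h2]
    congr 3
    refine Prod.ext ?_ ?_
    · apply Complex.ext <;> simp [hsθ]
    · simp [hsθ, hsω]; ring
  intro v
  refine hd.induction_on (p := fun v => W (ρ.V p v) = ρ.V (hsθ p) (W v)) v ?_ this
  exact isClosed_eq (W.continuous.comp (ρ.V p).continuous) ((ρ.V (hsθ p)).continuous.comp W.continuous)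

end HsRep
end HsPart9

section HsPart10
open Filter Topology MeasureTheory Set
open scoped InnerProductSpace

namespace H3System
variable (s : H3System)

/-- Koopman operator. -/
noncomputable def koop (g : H3) : Lp ℂ 2 s.μ →ₗᵢ[ℂ] Lp ℂ 2 s.μ :=
  Lp.compMeasurePreservingₗᵢ ℂ (s.T g⁻¹) (s.t_mp g⁻¹)

lemma koop_coe (g : H3) (f : Lp ℂ 2 s.μ) :
    (s.koop g f : s.X → ℂ) =ᵐ[s.μ] fun x => (f : s.X → ℂ) (s.T g⁻¹ x) :=
  Lp.coeFn_compMeasurePreserving f (s.t_mp g⁻¹)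

lemma koop_one (f : Lp ℂ 2 s.μ) : s.koop 1 f = f := by
  refine Lp.ext ?_
  filter_upwards [s.koop_coe 1 f] with x hx
  rw [hx, inv_one, s.t_one]

lemma koop_mul (g h : H3) (f : Lp ℂ 2 s.μ) : s.koop g (s.koop h f) = s.koop (g * h) f := by
  refine Lp.ext ?_
  filter_upwards [s.koop_coe (g * h) f, s.koop_coe g (s.koop h f),
    (s.t_mp g⁻¹).quasiMeasurePreserving.ae (s.koop_coe h f)] with x h1 h2 h3
  rw [h1, h2, h3, mul_inv_rev, s.t_mul]

/-- Passage from symmetric coordinates to matrix coordinates. -/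
noncomputable def crd (p : ℂ × ℝ) : H3 := ⟨p.1.re, p.1.im, p.2 + p.1.re * p.1.im / 2⟩

lemma crd_mul (p q : ℂ × ℝ) :
    crd p * crd q = crd (p.1 + q.1, p.2 + q.2 + hsω p.1 q.1 / 2) := by
  ext
  · simp [crd]
  · simp [crd]
  · simp [crd, hsω]; ring

lemma measurable_H3 {α : Type*} [MeasurableSpace α] (f : α → H3) (ha : Measurable fun x => (f x).a)
    (hb : Measurable fun x => (f x).b) (hc : Measurable fun x => (f x).c) : Measurable f :=
  measurable_comap_iff.2 (ha.prodMk (hb.prodMk hc))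

lemma koop_inner_meas [SFinite s.μ] (v w : Lp ℂ 2 s.μ) :
    Measurable fun p => ⟪w, s.koop (crd p) v⟫_ℂ := by
  have e : ∀ p, ⟪w, s.koop (crd p) v⟫_ℂ
      = ∫ x, ⟪(w : s.X → ℂ) x, (v : s.X → ℂ) (s.T (crd p)⁻¹ x)⟫_ℂ ∂s.μ := by
    intro p
    rw [L2.inner_def]
    refine integral_congr_ae ?_
    filter_upwards [s.koop_coe (crd p) v] with x hx
    rw [hx]
  simp_rw [e]
  have hm : Measurable fun q : (ℂ × ℝ) × s.X => s.T (crd q.1)⁻¹ q.2 := by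
    refine s.t_meas.comp (Measurable.prodMk (measurable_H3 _ ?_ ?_ ?_) measurable_snd)
    all_goals simp only [crd, H3.inv_a, H3.inv_b, H3.inv_c]; fun_prop
  have hv : StronglyMeasurable fun q : (ℂ × ℝ) × s.X => (v : s.X → ℂ) (s.T (crd q.1)⁻¹ q.2) :=
    (Lp.stronglyMeasurable v).comp_measurable hm
  have hw : StronglyMeasurable fun q : (ℂ × ℝ) × s.X => (w : s.X → ℂ) q.2 :=
    (Lp.stronglyMeasurable w).comp_measurable measurable_snd
  exact (StronglyMeasurable.integral_prod_right (hw.inner hv)).measurable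

noncomputable def rep [SFinite s.μ] : HsRep (Lp ℂ 2 s.μ) where
  V p := s.koop (crd p)
  zero v := by
    have : crd (0, 0) = 1 := by ext <;> simp [crd]
    rw [this, koop_one]
  mul p q v := by rw [koop_mul, crd_mul]
  meas v w := s.koop_inner_meas v w

lemma const_of_fixed [SFinite s.μ] (herg : s.CentralErgodic) (w : s.X → ℂ) (hw : Measurable w)
    (hf : ∀ t, (fun x => w (s.T (H3.C t) x)) =ᵐ[s.μ] w) : ∃ c, w =ᵐ[s.μ] Function.const _ c := by
  refine Filter.exists_eventuallyEq_const_of_forall_separating MeasurableSet fun B hB => ?_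
  have hT : Measurable fun q : s.X × ℝ => s.T (H3.C q.2) q.1 := by
    refine s.t_meas.comp (Measurable.prodMk (measurable_H3 _ ?_ ?_ ?_) measurable_fst)
    all_goals simp only [H3.C]; fun_prop
  have hwT := hw.comp hT
  let N : Set (s.X × ℝ) := {q | w (s.T (H3.C q.2) q.1) ∉ B}
  have hN : MeasurableSet N := (hwT hB).compl
  let A : Set s.X := {x | volume (Prod.mk x ⁻¹' N) = 0}
  have hA : MeasurableSet A := (measurable_measure_prodMk_left hN) (measurableSet_singleton 0)
  have hinv : ∀ t, s.T (H3.C t) ⁻¹' A = A := by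
    intro t
    ext x
    have : Prod.mk (s.T (H3.C t) x) ⁻¹' N = (fun r => r + t) ⁻¹' (Prod.mk x ⁻¹' N) := by
      ext r
      have : H3.C (r + t) = H3.C r * H3.C t := by ext <;> simp [H3.C]
      simp [N, this, s.t_mul]
    simp only [A, mem_preimage, mem_setOf_eq]
    rw [this, measure_preimage_add_right]
  have hae : ∀ᵐ x ∂s.μ, ∀ᵐ t ∂(volume : Measure ℝ), w (s.T (H3.C t) x) = w x := by
    rw [Measure.ae_ae_comm]
    · exact ae_of_all _ hf
    · exact measurableSet_eq_fun hwT (hw.comp measurable_fst)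
  have hAB : ∀ᵐ x ∂s.μ, (x ∈ A ↔ w x ∈ B) := by
    filter_upwards [hae] with x hx
    have e : x ∈ A ↔ ∀ᵐ t ∂(volume : Measure ℝ), w (s.T (H3.C t) x) ∈ B := by
      rw [ae_iff]; rfl
    rw [e]
    constructor
    · intro h
      obtain ⟨t, h1, h2⟩ := (h.and hx).exists
      rwa [← h2]
    · intro h
      filter_upwards [hx] with t ht
      rwa [ht]
  rcases herg A hA hinv with h | h
  · right
    filter_upwards [hAB, measure_eq_zero_iff_ae_notMem.1 h] with x h1 h2
    rwa [← h1]
  · left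
    filter_upwards [hAB, measure_eq_zero_iff_ae_notMem.1 h] with x h1 h2
    rw [← h1]
    simpa using h2

lemma rep_fix [SFinite s.μ] (herg : s.CentralErgodic) (w : Lp ℂ 2 s.μ)
    (h : ∀ t, s.rep.V (0, t) w = w) (p : ℂ × ℝ) : s.rep.V p w = w := by
  obtain ⟨c, hc⟩ := s.const_of_fixed herg w (Lp.stronglyMeasurable w).measurable (by
    intro t
    have h1 : s.koop (crd (0, -t)) w = w := h (-t)
    have h2 := s.koop_coe (crd (0, -t)) w
    rw [h1] at h2
    have e : (crd (0, -t))⁻¹ = H3.C t := by ext <;> simp [crd, H3.C]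
    rw [e] at h2
    exact h2.symm)
  refine Lp.ext ?_
  have h2 := s.koop_coe (crd p) w
  filter_upwards [h2, hc, (s.t_mp (crd p)⁻¹).quasiMeasurePreserving.ae hc] with x h1 h2 h3
  rw [h2]
  refine h1.trans h3

lemma exists_flip (hstd : s.IsStdProb) (herg : s.CentralErgodic) :
    ∃ W : Lp ℂ 2 s.μ ≃ₗᵢ[ℂ] Lp ℂ 2 s.μ, ∀ g f, W (s.koop g f) = s.koop (H3.flip g) (W f) := by
  obtain ⟨hb, hp⟩ := hstd
  haveI : Fact ((2 : ENNReal) ≠ ⊤) := ⟨by simp⟩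
  obtain ⟨W, hW⟩ := s.rep.exists_flip (s.rep_fix herg) (fun f => star f) (by
    intro x y
    rw [L2.inner_def, L2.inner_def]
    refine integral_congr_ae ?_
    filter_upwards [Lp.coeFn_star x, Lp.coeFn_star y] with t h1 h2
    rw [h1, h2]
    simp [mul_comm]) (fun x => star_star x) (by
    intro p v
    refine Lp.ext ?_
    have h3 := s.koop_coe (crd p) v
    have h4 := s.koop_coe (crd p) (star v)
    filter_upwards [Lp.coeFn_star (s.rep.V p v), h3, h4,
      (s.t_mp (crd p)⁻¹).quasiMeasurePreserving.ae (Lp.coeFn_star v)] with x h1 h2 h3 h4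
    rw [h1, Pi.star_apply]
    refine (congrArg star h2).trans ?_
    refine Eq.trans ?_ h3.symm
    rw [h4, Pi.star_apply])
  refine ⟨W, fun g f => ?_⟩
  have e1 : crd (⟨g.a, g.b⟩, g.c - g.a * g.b / 2) = g := by ext <;> simp [crd]
  have e2 : crd (hsθ (⟨g.a, g.b⟩, g.c - g.a * g.b / 2)) = H3.flip g := by
    ext
    · simp [crd, hsθ, H3.flip]
    · simp [crd, hsθ, H3.flip]
    · simp [crd, hsθ, H3.flip]; ring
  have := hW (⟨g.a, g.b⟩, g.c - g.a * g.b / 2) f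
  simpa only [rep, e1, e2] using this

lemma exists_flip' (hstd : s.IsStdProb) (herg : s.CentralErgodic) :
    ∃ W : Lp ℂ 2 s.μ ≃ₗᵢ[ℂ] Lp ℂ 2 s.μ,
      ∀ (g : H3) (f f' : Lp ℂ 2 s.μ),
        ((f' : s.X → ℂ) =ᵐ[s.μ] fun x => (f : s.X → ℂ) (s.T g⁻¹ x)) →
        ((W f' : s.X → ℂ) =ᵐ[s.μ] fun x => (W f : s.X → ℂ) (s.T (H3.flip g)⁻¹ x)) := by
  obtain ⟨W, hW⟩ := s.exists_flip hstd herg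
  refine ⟨W, fun g f f' h => ?_⟩
  have : f' = s.koop g f := Lp.ext (h.trans (s.koop_coe g f).symm)
  rw [this, hW]
  exact s.koop_coe _ _

end H3System
end HsPart10

section Statement
open MeasureTheory

/-- **Remark (Section 8(8)).** Let `T` be a measure-preserving action of `H₃(ℝ)` on a
standard probability space whose central flow `(T_{c(t)})_{t∈ℝ}` is ergodic. Then `T` is
spectrally symmetric: the Koopman representation `U_T` is unitarily equivalent to
`U_T ∘ θ`, where `θ` is the flip automorphism of `H₃(ℝ)`; a unitary `W` on `L²(X,μ)`
intertwines `U_T(g)` with `U_T(θ(g))` for all `g`. In particular, the flows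
`(T_{a(t)})_{t∈ℝ}` and `(T_{b(t)})_{t∈ℝ}` have the same maximal spectral type (they are
unitarily equivalent). -/
theorem spectrally_symmetric_of_centralErgodic (s : H3System) (hstd : s.IsStdProb)
    (herg : s.CentralErgodic) :
    (∃ W : Lp ℂ 2 s.μ ≃ₗᵢ[ℂ] Lp ℂ 2 s.μ,
      ∀ (g : H3) (f f' : Lp ℂ 2 s.μ),
        ((f' : s.X → ℂ) =ᵐ[s.μ] fun x => (f : s.X → ℂ) (s.T g⁻¹ x)) →
        ((W f' : s.X → ℂ) =ᵐ[s.μ] fun x => (W f : s.X → ℂ) (s.T (H3.flip g)⁻¹ x))) ∧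
    (∃ W : Lp ℂ 2 s.μ ≃ₗᵢ[ℂ] Lp ℂ 2 s.μ,
      ∀ (t : ℝ) (f f' : Lp ℂ 2 s.μ),
        ((f' : s.X → ℂ) =ᵐ[s.μ] fun x => (f : s.X → ℂ) (s.T (H3.A t)⁻¹ x)) →
        ((W f' : s.X → ℂ) =ᵐ[s.μ] fun x => (W f : s.X → ℂ) (s.T (H3.B t)⁻¹ x))) := by
  obtain ⟨W, hW⟩ := s.exists_flip' hstd herg
  refine ⟨⟨W, hW⟩, W, fun t f f' h => ?_⟩
  have e : H3.flip (H3.A t) = H3.B t := by ext <;> simp [H3.flip, H3.A, H3.B]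
  have := hW (H3.A t) f f' h
  rwa [e] at this

end Statement
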